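/- arXiv:0710.0152 — 3 statements merged into one kernel-verified Lean document; each statement's English description precedes it below -/
import Mathlib

section
/- Let (X,(f_n)) be a converging situation. Then the following statements are equivalent: (a) A^f is ≤ʳ_c-minimal among non-pot(Π⁰₁) Borel sets; (b) for every Borel subset B of X and every finer Polish topology τ on B, if A^f ∩ B² is not pot(Π⁰₁) then A^f ≤ʳ_c A^f ∩ B²; (c) for every Borel subset B of X and every finer topology τ on B such that ([B,τ],(f^B_n)_n) is a converging situation, A^f ≤ʳ_c A^f ∩ B². -/
open Set Topology

abbrev Cantor : Type := ℕ → Bool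

/-- `A ⊆ X × Y` is potentially closed (`pot(Π⁰₁)`): there are finer Polish topologies on `X`
and `Y` making `A` closed in the product. -/
def PotClosed {X Y : Type} (tX : TopologicalSpace X) (tY : TopologicalSpace Y)
    (A : Set (X × Y)) : Prop :=
  ∃ (σ : TopologicalSpace X) (τ : TopologicalSpace Y),
    σ ≤ tX ∧ τ ≤ tY ∧ @PolishSpace X σ ∧ @PolishSpace Y τ ∧
    @IsClosed (X × Y) (@instTopologicalSpaceProd X Y σ τ) A

/-- Membership in the class `D₂(Σ⁰₁)`: difference of two open sets. -/
def D2Sigma01 {Z : Type} (t : TopologicalSpace Z) (A : Set Z) : Prop :=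
  ∃ U V : Set Z, @IsOpen Z t U ∧ @IsOpen Z t V ∧ A = U \ V

/-- The rectangular continuous reducibility `A ≤ʳ_c A'`. -/
def RedRC {X Y X' Y' : Type} (tX : TopologicalSpace X) (tY : TopologicalSpace Y)
    (tX' : TopologicalSpace X') (tY' : TopologicalSpace Y')
    (A : Set (X × Y)) (A' : Set (X' × Y')) : Prop :=
  ∃ (u : X → X') (v : Y → Y'),
    @Continuous X X' tX tX' u ∧ @Continuous Y Y' tY tY' v ∧
    A = (fun p => (u p.1, v p.2)) ⁻¹' A'

/-- `≤ʳ_c` on subsets of `Cantor × Cantor` with the standard topology. -/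
def RedC2 (A A' : Set (Cantor × Cantor)) : Prop :=
  RedRC inferInstance inferInstance inferInstance inferInstance A A'

/-- `A` is `≤ʳ_c`-minimal among non-potentially closed Borel sets. -/
def MinNonPotClosed {X Y : Type} (tX : TopologicalSpace X) (tY : TopologicalSpace Y)
    (A : Set (X × Y)) : Prop :=
  ¬ PotClosed tX tY A ∧
  ∀ (X' Y' : Type) (tX' : TopologicalSpace X') (tY' : TopologicalSpace Y'),
    @PolishSpace X' tX' → @PolishSpace Y' tY' →
    ∀ A' : Set (X' × Y'),
      @MeasurableSet (X' × Y') (@borel (X' × Y') (@instTopologicalSpaceProd X' Y' tX' tY')) A' →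
      ¬ PotClosed tX' tY' A' →
      RedRC tX' tY' tX tY A' A → RedRC tX tY tX' tY' A A'

/-- The Borel reducibility `A ≤_B A'` for square sets. -/
def RedB {Z Z' : Type} (tZ : TopologicalSpace Z) (tZ' : TopologicalSpace Z')
    (A : Set (Z × Z)) (A' : Set (Z' × Z'))  : Prop :=
  ∃ u : Z → Z', @Measurable Z Z' (@borel Z tZ) (@borel Z' tZ') u ∧
    A = (fun p => (u p.1, u p.2)) ⁻¹' A'

/-- `A` is `≤_B`-minimal among non-potentially closed Borel (square) sets. -/
def MinBNonPotClosed {Z : Type} (tZ : TopologicalSpace Z) (A : Set (Z × Z)) : Prop :=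
  ¬ PotClosed tZ tZ A ∧
  ∀ (Z' : Type) (tZ' : TopologicalSpace Z'), @PolishSpace Z' tZ' →
    ∀ A' : Set (Z' × Z'),
      @MeasurableSet (Z' × Z') (@borel (Z' × Z') (@instTopologicalSpaceProd Z' Z' tZ' tZ')) A' →
      ¬ PotClosed tZ' tZ' A' →
      RedB tZ' tZ A' A → RedB tZ tZ' A A'

/-- The graph of the partial function `f` with domain `D`. -/
def graphRel {X : Type} (D : Set X) (f : X → X) : Set (X × X) :=
  {p | p.1 ∈ D ∧ p.2 = f p.1}

/-- `A^f := ⋃ₙ Graph(fₙ)`. -/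
def unionGraphs {X : Type} (D : ℕ → Set X) (f : ℕ → X → X) : Set (X × X) :=
  ⋃ n, graphRel (D n) (f n)

/-- `f` restricted to `D` is a partial homeomorphism with clopen domain and clopen range. -/
def IsPartialHomeo {X : Type} (t : TopologicalSpace X) (D : Set X) (f : X → X) : Prop :=
  @IsClopen X t D ∧ @IsClopen X t (f '' D) ∧ @ContinuousOn X X t t f D ∧
    ∃ g : X → X, @ContinuousOn X X t t g (f '' D) ∧ ∀ x ∈ D, g (f x) = x

/-- A converging situation: a nonempty zero-dimensional perfect Polish space together with
partial homeomorphisms with clopen domains and ranges such that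
`Δ(X) = closure(A^f) \ A^f`. -/
def ConvSit (X : Type) (t : TopologicalSpace X) (D : ℕ → Set X) (f : ℕ → X → X) : Prop :=
  Nonempty X ∧ @PolishSpace X t ∧
  @TopologicalSpace.IsTopologicalBasis X t {s : Set X | @IsClopen X t s} ∧
  @Perfect X t Set.univ ∧
  (∀ n, IsPartialHomeo t (D n) (f n)) ∧
  Set.diagonal X =
    @closure (X × X) (@instTopologicalSpaceProd X X t t) (unionGraphs D f) \ unionGraphs D f

/-- The domain of the restriction `f^B` of the partial map `(D, f)` to a subset `B`. -/
def subD {X : Type} (B : Set X) (D : Set X) (f : X → X) : Set ↥B :=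
  {x | (x : X) ∈ D ∧ f (x : X) ∈ B}

/-- The restriction `f^B` of `f` to `B`, as a map of the subtype (junk value outside). -/
noncomputable def subF {X : Type} (B : Set X) (f : X → X) : ↥B → ↥B :=
  fun x =>
    letI := Classical.dec (f (x : X) ∈ B)
    if h : f (x : X) ∈ B then ⟨f (x : X), h⟩ else x

/-- `A^f ∩ B²`, viewed on the subtype `B`: the union of the graphs of the `f^B_n`'s. -/
def restrGraphs {X : Type} (B : Set X) (D : ℕ → Set X) (f : ℕ → X → X) : Set (↥B × ↥B) :=
  unionGraphs (fun n => subD B (D n) (f n)) (fun n => subF B (f n))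

/-- The subspace topology on `B` induced by a topology `t` on `X`. -/
def subTop {X : Type} (t : TopologicalSpace X) (B : Set X) : TopologicalSpace ↥B :=
  @TopologicalSpace.induced ↥B X Subtype.val t

/-- The natural bijection `ψ : ω → 2^{<ω}` (enumeration by length, then lexicographically):
`ψ(n)` is the binary expansion of `n+1` with its leading one removed. -/
def psiSeq (n : ℕ) : List Bool := ((n + 1).bits.dropLast).reverse

/-- `s_n := ψ(n)0^{n-|ψ(n)|}`, a dense sequence with `|s_n| = n`. -/
def sSeq (n : ℕ) : List Bool := psiSeq n ++ List.replicate (n - (psiSeq n).length) false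

/-- The concatenation `sγ` of a finite sequence `s` with `γ ∈ 2^ω`. -/
def catSeq (s : List Bool) (γ : Cantor) : Cantor :=
  fun i => if h : i < s.length then s.get ⟨i, h⟩ else γ (i - s.length)

/-- `A₁ := {(s_n0γ, s_n1γ) : n ∈ ω, γ ∈ 2^ω}`. -/
def A1 : Set (Cantor × Cantor) :=
  {p | ∃ (n : ℕ) (γ : Cantor),
    p.1 = catSeq (sSeq n ++ [false]) γ ∧ p.2 = catSeq (sSeq n ++ [true]) γ}

/-- `Card(x↾n)`: the number of ones among the first `n` coordinates of `x`. -/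
def cardOnes (x : Cantor) (n : ℕ) : ℕ := ∑ i ∈ Finset.range n, (if x i then 1 else 0)

/-- The domain of `f^S_n`: sequences vanishing at `n` whose first `n` coordinates contain a
number of ones belonging to `S`. -/
def DSdom (S : Set ℕ) (n : ℕ) : Set Cantor := {x | x n = false ∧ cardOnes x n ∈ S}

/-- `f^S_n (s0γ) := s1γ`: flip the `n`-th coordinate to one. -/
def fSfun (n : ℕ) : Cantor → Cantor := fun x => Function.update x n true

/-- `A^S := {(s0γ, s1γ) : s ∈ 2^{<ω}, Card(s) ∈ S, γ ∈ 2^ω} = ⋃ₙ Graph(f^S_n)`. -/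
def ASet (S : Set ℕ) : Set (Cantor × Cantor) := unionGraphs (DSdom S) fSfun

/-- Condition (M) on `S ⊆ ω`. -/
def CondM (S : Set ℕ) : Prop :=
  ∀ p : ℕ, ∃ k : ℕ, ∀ q : ℕ, ∃ c : ℕ, q ≤ c ∧ c ≤ q + k ∧
    (fun m => c + m) '' (S ∩ Set.Iic p) = S ∩ Set.Icc c (c + p)

/-- Condition (H) on `S ⊆ ω`. -/
def CondH (S : Set ℕ) : Prop :=
  ∀ C : Set Cantor, @MeasurableSet Cantor (borel Cantor) C →
    ∀ σ : TopologicalSpace ↥C, σ ≤ subTop inferInstance C →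
      ConvSit ↥C σ (fun n => subD C (DSdom S n) (fSfun n)) (fun n => subF C (fSfun n)) →
      ∀ l p : ℕ, ∃ n : ℕ, l ≤ n ∧ ∃ γ : ↥C, γ ∈ subD C (DSdom S n) (fSfun n) ∧
        (fun m => cardOnes (γ : Cantor) n + m) '' (S ∩ Set.Iic p) =
          S ∩ Set.Icc (cardOnes (γ : Cantor) n) (cardOnes (γ : Cantor) n + p)

/-- Condition (⊥) on a pair `(S, S')`. -/
def CondPerp (S S' : Set ℕ) : Prop :=
  ∃ p : ℕ, ∀ c : ℕ, (fun m => c + m) '' (S ∩ Set.Iic p) ≠ S' ∩ Set.Icc c (c + p)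

/-- Condition (⊥⁻¹) on a pair `(S, S')` (stated in `ℤ` to handle subtraction). -/
def CondPerpInv (S S' : Set ℕ) : Prop :=
  ∃ p : ℕ, ∀ c : ℕ,
    (fun m : ℕ => (c : ℤ) - (m : ℤ)) '' (S ∩ Set.Iic p) ≠
      ((fun n : ℕ => (n : ℤ)) '' S') ∩ Set.Icc ((c : ℤ) - (p : ℤ)) (c : ℤ)

/-- `A⁻¹ := {(y,x) : (x,y) ∈ A}`. -/
def invRel {X : Type} (A : Set (X × X)) : Set (X × X) := {p | (p.2, p.1) ∈ A}

/-- `γ_α`: `γ_α(4n+2ε) = ε` and `γ_α(2n+1) = α(n)`. -/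
def gammaSeq (α : Cantor) (k : ℕ) : Bool :=
  if k % 2 = 1 then α (k / 2) else decide (k % 4 = 2)

/-- `β_α(i) := γ_α((i)₀)` where `(i)₀ = max {m : 2^m ∣ i+1}`, with values in `{0,1} ⊆ ω`. -/
def betaSeq (α : Cantor) (i : ℕ) : ℕ :=
  if gammaSeq α ((i + 1).factorization 2) then 1 else 0

/-- `S_β := {Σ_{i<l} (1 + β(i)) : l ∈ ω}`. -/
def Sbeta (β : ℕ → ℕ) : Set ℕ :=
  {m | ∃ l : ℕ, m = ∑ i ∈ Finset.range l, (1 + β i)}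

/-- `s_n` as a function `ℕ → Bool` (with junk value `false` beyond `n`). -/
def sSeqFn (n : ℕ) (i : ℕ) : Bool := (sSeq n).getD i false

/-- The domain of `f¹_n` (direction `d = true`) or of `(f¹_n)⁻¹` (direction `d = false`):
`x` extends `s_n` and `x(n) = !d`. -/
def step1Dom (n : ℕ) (d : Bool) : Set Cantor :=
  {x | (∀ i, i < n → x i = sSeqFn n i) ∧ x n = !d}

/-- `f¹_n` (if `d = true`) or its inverse (if `d = false`): set the `n`-th coordinate to `d`. -/
def step1Fun (n : ℕ) (d : Bool) : Cantor → Cantor := fun x => Function.update x n d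

/-- Domain of `fₙ` (direction `d = true`) or of `fₙ⁻¹` (direction `d = false`). -/
def stepDom {X : Type} (D : ℕ → Set X) (f : ℕ → X → X) (n : ℕ) (d : Bool) : Set X :=
  if d then D n else f n '' D n

/-- `fₙ` (direction `d = true`) or its inverse `gₙ` (direction `d = false`). -/
def stepFun {X : Type} (f g : ℕ → X → X) (n : ℕ) (d : Bool) : X → X :=
  if d then f n else g n

/-- An acyclic situation (Definition 26), with `g n` the inverse of `f n`. -/
def AcyclicSit (X : Type) (t : TopologicalSpace X) (D : ℕ → Set X) (f g : ℕ → X → X) : Prop :=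
  Nonempty X ∧ @PolishSpace X t ∧
  @TopologicalSpace.IsTopologicalBasis X t {s : Set X | @IsClopen X t s} ∧
  @Perfect X t Set.univ ∧
  (∀ n, IsPartialHomeo t (D n) (f n)) ∧
  (∀ n, ∀ x ∈ D n, g n (f n x) = x) ∧
  Set.diagonal X ⊆
    @closure (X × X) (@instTopologicalSpaceProd X X t t) (unionGraphs D f) \ unionGraphs D f ∧
  (∀ m : ℕ, 1 ≤ m → ∀ (v : ℕ → ℕ) (ε : ℕ → Bool),
    (∀ i, i + 1 < m → v i ≠ v (i + 1) ∨ ε i = ε (i + 1)) →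
    ∀ U : Set X, @IsClopen X t U → U.Nonempty →
      ∃ V : Set X, @IsClopen X t V ∧ V.Nonempty ∧ V ⊆ U ∧
        ∀ x ∈ V, ∀ w : ℕ → X, w 0 = x →
          (∀ i, i < m → w i ∈ stepDom D f (v i) (ε i) ∧
            w (i + 1) = stepFun f g (v i) (ε i) (w i)) →
          w m ∉ V)

/-- The relation `ℜ_Θ` on `2^{<ω}`: `e ℜ_Θ e'` iff `e = e'` or
`(e, e') = (θ_n0w, θ_n1w)` for some `n` and `w`. -/
def RTheta (θ : ℕ → List Bool) (e e' : List Bool) : Prop :=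
  e = e' ∨ ∃ (n : ℕ) (w : List Bool), e = θ n ++ false :: w ∧ e' = θ n ++ true :: w

/-- The symmetrization `s(ℜ_Θ)`. -/
def sRTheta (θ : ℕ → List Bool) (e e' : List Bool) : Prop :=
  RTheta θ e e' ∨ RTheta θ e' e

section

open Filter TopologicalSpace MeasureTheory

theorem exists_polishSpace_forall_isClopen {X ι : Type*} [Countable ι] [t : TopologicalSpace X]
    [PolishSpace X] (S : ι → Set X) (hS : ∀ i, MeasurableSet[borel X] (S i)) :
    ∃ T : TopologicalSpace X, T ≤ t ∧ @PolishSpace X T ∧ ∀ i, @IsClopen _ T (S i) := by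
  borelize X
  choose m hm hmP hmc hmo using fun i => (hS i).isClopenable
  obtain ⟨T, hT, hTt, hTP⟩ := PolishSpace.exists_polishSpace_forall_le m hm hmP
  exact ⟨T, hTt, hTP, fun i => ⟨(hmc i).mono (hT i), hT i _ (hmo i)⟩⟩

theorem exists_polishSpace_refinement {X κ : Type*} [Countable κ] {t : TopologicalSpace X}
    (D : κ → Set X) (F : κ → X → X)
    (hF : ∀ k O, MeasurableSet[@borel X t] O → MeasurableSet[@borel X t] (D k ∩ F k ⁻¹' O))
    (T : TopologicalSpace X) (hTt : T ≤ t) (ht : @PolishSpace X t) (hT : @PolishSpace X T) :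
    ∃ T' : TopologicalSpace X, T' ≤ T ∧ @PolishSpace X T' ∧
      (∃ b : Set (Set X), @IsTopologicalBasis X T b ∧ ∀ s ∈ b, @IsClopen _ T' s) ∧
      ∀ k O, IsOpen[T] O → IsOpen[T'] (D k ∩ F k ⁻¹' O) := by
  have hbor : @borel X t = @borel X T := (MeasureTheory.borel_eq_borel_of_le hT ht hTt).symm
  rw [hbor] at hF
  obtain ⟨b, hbc, -, hb⟩ := TopologicalSpace.exists_countable_basis X
  have := hbc.to_subtype
  have hbm : ∀ s ∈ b, MeasurableSet[@borel X T] s := fun s hs =>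
    MeasurableSpace.measurableSet_generateFrom (hb.isOpen hs)
  obtain ⟨T', hT'T, hT'P, hc⟩ := exists_polishSpace_forall_isClopen
    (fun i : b ⊕ (κ × b) => Sum.elim (fun s : b => (s : Set X))
      (fun p : κ × b => D p.1 ∩ F p.1 ⁻¹' (p.2 : Set X)) i) (by
      rintro (s | ⟨k, s⟩)
      · exact hbm _ s.2
      · exact hF k _ (hbm _ s.2))
  refine ⟨T', hT'T, hT'P, ⟨b, hb, fun s hs => hc (Sum.inl ⟨s, hs⟩)⟩, fun k O hO => ?_⟩
  obtain ⟨S, hS, rfl⟩ := @IsTopologicalBasis.open_eq_sUnion _ T _ hb _ hO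
  rw [preimage_sUnion, inter_iUnion₂]
  refine @isOpen_biUnion _ _ T' _ _ fun s hs => ?_
  exact (hc (Sum.inr (k, ⟨s, hS hs⟩))).isOpen

theorem exists_mem_nhds_of_iInf {X : Type*} {T : ℕ → TopologicalSpace X} (hT : Antitone T) {x : X}
    {U : Set X} (hU : IsOpen[⨅ n, T n] U) (hx : x ∈ U) : ∃ n, ∃ V ⊆ U, IsOpen[T n] V ∧ x ∈ V := by
  have h : U ∈ @nhds X (⨅ n, T n) x := @IsOpen.mem_nhds X (⨅ n, T n) _ _ hU hx
  rw [nhds_iInf, mem_iInf_of_directed] at h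
  · obtain ⟨n, hn⟩ := h
    obtain ⟨V, hV⟩ := (@mem_nhds_iff X (T n) _ _).1 hn
    exact ⟨n, V, hV⟩
  · exact Antitone.directed_ge fun m n h => nhds_mono (hT h)

theorem exists_zeroDim_polishSpace {X ι κ : Type*} [Countable ι] [Countable κ]
    [t : TopologicalSpace X] [ht : PolishSpace X] (S : ι → Set X)
    (hS : ∀ i, MeasurableSet[borel X] (S i)) (D : κ → Set X) (F : κ → X → X)
    (hF : ∀ k O, MeasurableSet[borel X] O → MeasurableSet[borel X] (D k ∩ F k ⁻¹' O)) :
    ∃ T : TopologicalSpace X, T ≤ t ∧ @PolishSpace X T ∧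
      @IsTopologicalBasis X T {s | @IsClopen _ T s} ∧ (∀ i, @IsClopen _ T (S i)) ∧
      ∀ k O, IsOpen[T] O → IsOpen[T] (D k ∩ F k ⁻¹' O) := by
  obtain ⟨T₀, hT₀, hT₀P, hT₀c⟩ := exists_polishSpace_forall_isClopen S hS
  choose! R hR hRP hRb hRF using fun (T : TopologicalSpace X) (h : T ≤ t ∧ @PolishSpace X T) =>
    exists_polishSpace_refinement D F hF T h.1 ht h.2
  let T : ℕ → TopologicalSpace X := fun n => R^[n] T₀
  have hsucc : ∀ n, T (n + 1) = R (T n) := fun n => Function.iterate_succ_apply' R n T₀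
  have hT : ∀ n, T n ≤ t ∧ @PolishSpace X (T n) := by
    intro n
    induction n with
    | zero => exact ⟨hT₀, hT₀P⟩
    | succ n ih =>
      rw [hsucc]
      exact ⟨(hR _ ih).trans ih.1, hRP _ ih⟩
  have hanti : Antitone T := antitone_nat_of_succ_le fun n => hsucc n ▸ hR _ (hT n)
  have hle : ∀ n, ⨅ n, T n ≤ T n := iInf_le T
  refine ⟨⨅ n, T n, (hle 0).trans (hT 0).1, .iInf ⟨0, fun n => hanti n.zero_le⟩ fun n => (hT n).2,
    ?_, fun i => ⟨(hT₀c i).isClosed.mono (hle 0), hle 0 _ (hT₀c i).isOpen⟩, fun k O hO => ?_⟩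
  · refine @isTopologicalBasis_of_isOpen_of_nhds _ (⨅ n, T n) _
      (fun s (hs : @IsClopen _ (⨅ n, T n) s) => @IsClopen.isOpen _ (⨅ n, T n) _ hs) fun x U hx hU => ?_
    obtain ⟨n, V, hVU, hV, hxV⟩ := exists_mem_nhds_of_iInf hanti hU hx
    obtain ⟨b, hb, hbc⟩ := hRb _ (hT n)
    obtain ⟨s, hs, hxs, hsV⟩ := @IsTopologicalBasis.exists_subset_of_mem_open _ (T n) _ hb _ _ hxV hV
    have hc := hbc s hs
    rw [← hsucc] at hc
    exact ⟨s, ⟨@IsClosed.mono _ _ _ _ (@IsClopen.isClosed _ (T (n + 1)) _ hc) (hle _),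
      hle _ _ (@IsClopen.isOpen _ (T (n + 1)) _ hc)⟩, hxs, hsV.trans hVU⟩
  · refine (@isOpen_iff_forall_mem_open _ (⨅ n, T n) _).2 fun x hx => ?_
    obtain ⟨n, V, hVU, hV, hxV⟩ := exists_mem_nhds_of_iInf hanti hO hx.2
    refine ⟨D k ∩ F k ⁻¹' V, inter_subset_inter_right _ (preimage_mono hVU), hle (n + 1) _ ?_,
      hx.1, hxV⟩
    rw [hsucc]
    exact hRF _ (hT n) k V hV

theorem exists_residual_forall_isOpen {X : Type*} {t σ : TopologicalSpace X}
    (ht : @PolishSpace X t) (hσt : σ ≤ t) (hσ : @PolishSpace X σ) :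
    ∃ G ∈ @residual X t, ∀ O, IsOpen[σ] O → ∀ x ∈ O ∩ G, ∃ V, IsOpen[t] V ∧ x ∈ V ∧ V ∩ G ⊆ O := by
  have hbor : @borel X σ = @borel X t := MeasureTheory.borel_eq_borel_of_le hσ ht hσt
  obtain ⟨b, hbc, -, hb⟩ := @TopologicalSpace.exists_countable_basis X σ _
  have := hbc.to_subtype
  have hV : ∀ s : b, ∃ V : Set X, IsOpen[t] V ∧ (s : Set X) =ᶠ[@residual X t] V := by
    intro s
    let _ : MeasurableSpace X := @borel X t
    have : @BorelSpace X t _ := @BorelSpace.mk X t _ rfl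
    refine @MeasurableSet.residualEq_isOpen X t _ _ _ ?_
    change MeasurableSet[@borel X t] (s : Set X)
    rw [← hbor]
    exact MeasurableSpace.measurableSet_generateFrom
      (@IsTopologicalBasis.isOpen X σ _ _ hb s.2)
  choose V hVo hV using hV
  refine ⟨{x | ∀ s : b, x ∈ (s : Set X) ↔ x ∈ V s}, ?_, fun O hO x hx => ?_⟩
  · exact (eventually_countable_forall (l := @residual X t)).2 fun s => (hV s).mem_iff
  · obtain ⟨s, hs, hxs, hsO⟩ :=
      @IsTopologicalBasis.exists_subset_of_mem_open X σ _ hb x O hx.1 hO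
    exact ⟨V ⟨s, hs⟩, hVo _, (hx.2 ⟨s, hs⟩).1 hxs, fun y hy => hsO ((hy.2 ⟨s, hs⟩).2 hy.1)⟩

theorem IsPartialHomeo.isOpen_image {X : Type} [t : TopologicalSpace X] {D : Set X} {f : X → X}
    (h : IsPartialHomeo t D f) {O : Set X} (hO : IsOpen O) : IsOpen (f '' (D ∩ O)) := by
  obtain ⟨-, hR, -, g, hg, hgf⟩ := h
  convert! hg.isOpen_inter_preimage hR.isOpen hO using 1
  ext y
  constructor
  · rintro ⟨x, ⟨hxD, hxO⟩, rfl⟩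
    exact ⟨mem_image_of_mem f hxD, by rwa [mem_preimage, hgf x hxD]⟩
  · rintro ⟨⟨x, hxD, rfl⟩, hx⟩
    rw [mem_preimage, hgf x hxD] at hx
    exact ⟨x, ⟨hxD, hx⟩, rfl⟩

theorem IsPartialHomeo.eventually_residual {X : Type} [t : TopologicalSpace X] {D : Set X}
    {f : X → X} (h : IsPartialHomeo t D f) {G : Set X} (hG : G ∈ residual X) :
    ∀ᶠ x in residual X, x ∈ D → f x ∈ G := by
  have hD := h.1
  obtain ⟨S, hSo, hSd, hSc, hSG⟩ := mem_residual_iff.1 hG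
  have key : ∀ O ∈ S, ∀ᶠ x in residual X, x ∈ D → f x ∈ O := by
    intro O hO
    have heq : {x | x ∈ D → f x ∈ O} = Dᶜ ∪ D ∩ f ⁻¹' O := by
      ext x
      by_cases hx : x ∈ D <;> simp [hx]
    refine residual_of_dense_open ?_ ?_
    · rw [heq]
      exact hD.isClosed.isOpen_compl.union (h.2.2.1.isOpen_inter_preimage hD.isOpen (hSo O hO))
    · refine dense_iff_inter_open.2 fun N hN ⟨x, hxN⟩ => ?_
      by_cases hx : x ∈ D
      · obtain ⟨_, ⟨y, hy, rfl⟩, hyO⟩ :=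
          (hSd O hO).inter_open_nonempty _ (h.isOpen_image hN) ⟨f x, x, ⟨hx, hxN⟩, rfl⟩
        exact ⟨y, hy.2, fun _ => hyO⟩
      · exact ⟨x, hxN, fun h => absurd h hx⟩
  filter_upwards [(eventually_countable_ball hSc).2 key] with x hx hxD
  exact hSG fun O hO => hx O hO hxD

theorem mem_unionGraphs {X : Type} {D : ℕ → Set X} {f : ℕ → X → X} {x y : X} :
    (x, y) ∈ unionGraphs D f ↔ ∃ n, x ∈ D n ∧ y = f n x := by
  simp [unionGraphs, graphRel]

theorem ConvSit.exists_of_mem_residual {X : Type} [t : TopologicalSpace X] {D : ℕ → Set X}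
    {f : ℕ → X → X} (h : ConvSit X t D f) {G : Set X} (hG : G ∈ residual X) :
    ∃ x ∈ G, (x, x) ∉ unionGraphs D f ∧ ∀ V, IsOpen V → x ∈ V →
      ∃ y ∈ V ∩ G, ∃ z ∈ V ∩ G, (y, z) ∈ unionGraphs D f := by
  obtain ⟨hne, hP, -, -, hf, hdiag⟩ := h
  have hGd : Dense {x | x ∈ G ∧ ∀ n, x ∈ D n → f n x ∈ G} :=
    dense_of_mem_residual (Filter.Eventually.and (p := (· ∈ G)) hG
      (eventually_countable_forall.2 fun n => (hf n).eventually_residual hG))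
  obtain ⟨x, hx⟩ := hGd.nonempty
  have hxx : (x, x) ∈ closure (unionGraphs D f) \ unionGraphs D f := hdiag ▸ mem_diagonal x
  refine ⟨x, hx.1, hxx.2, fun V hV hxV => ?_⟩
  obtain ⟨⟨y, z⟩, ⟨hy, hz⟩, hyz⟩ := mem_closure_iff.1 hxx.1 (V ×ˢ V) (hV.prod hV) ⟨hxV, hxV⟩
  obtain ⟨n, hyD, rfl⟩ := mem_unionGraphs.1 hyz
  obtain ⟨y', ⟨hy'V, hy'D, hfy'V⟩, hy'G, hfy'G⟩ := hGd.inter_open_nonempty _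
    (hV.inter ((hf n).2.2.1.isOpen_inter_preimage (hf n).1.isOpen hV)) ⟨y, hy, hyD, hz⟩
  exact ⟨y', ⟨hy'V, hy'G⟩, f n y', ⟨hfy'V, hfy'G n hy'D⟩, mem_unionGraphs.2 ⟨n, hy'D, rfl⟩⟩

theorem ConvSit.not_potClosed {X : Type} {t : TopologicalSpace X} {D : ℕ → Set X}
    {f : ℕ → X → X} (h : ConvSit X t D f) : ¬ PotClosed t t (unionGraphs D f) := by
  rintro ⟨σ, τ, hσt, hτt, hσ, hτ, hcl⟩
  obtain ⟨G₁, hG₁, hO₁⟩ := exists_residual_forall_isOpen h.2.1 hσt hσ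
  obtain ⟨G₂, hG₂, hO₂⟩ := exists_residual_forall_isOpen h.2.1 hτt hτ
  obtain ⟨x, hx, hxx, hA⟩ :=
    @ConvSit.exists_of_mem_residual X t D f h _ (inter_mem hG₁ hG₂)
  obtain ⟨O₁, O₂, ho₁, ho₂, hx₁, hx₂, hO⟩ := (@isOpen_prod_iff X X σ τ _).1
    (@IsClosed.isOpen_compl (X × X) (@instTopologicalSpaceProd X X σ τ) _ hcl) x x hxx
  obtain ⟨V₁, hV₁, hxV₁, hVO₁⟩ := hO₁ O₁ ho₁ x ⟨hx₁, hx.1⟩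
  obtain ⟨V₂, hV₂, hxV₂, hVO₂⟩ := hO₂ O₂ ho₂ x ⟨hx₂, hx.2⟩
  obtain ⟨y, hy, z, hz, hyz⟩ := hA _ (@IsOpen.inter X t V₁ V₂ hV₁ hV₂) ⟨hxV₁, hxV₂⟩
  exact hO ⟨hVO₁ ⟨hy.1.1, hy.2.1⟩, hVO₂ ⟨hz.1.2, hz.2.2⟩⟩ hyz

/-- A set containing no edge of the relation `A`. -/
def IsIndep {X : Type*} (A : Set (X × X)) (S : Set X) : Prop := ∀ x ∈ S, ∀ y ∈ S, (x, y) ∉ A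

/-- The first `n` coordinates of a point of the Cantor space. -/
def cantorRes (x : Cantor) (n : ℕ) : Fin n → Bool := fun i => x i

/-- Extension of a finite binary sequence by one digit. -/
abbrev bsnoc {n : ℕ} (t : Fin n → Bool) (c : Bool) : Fin (n + 1) → Bool :=
  Fin.snoc (α := fun _ => Bool) t c

theorem cantorRes_succ (x : Cantor) (n : ℕ) : cantorRes x (n + 1) = bsnoc (cantorRes x n) (x n) :=
  (Fin.snoc_init_self (α := fun _ => Bool) (cantorRes x (n + 1))).symm

theorem bsnoc_init {n : ℕ} (t : Fin (n + 1) → Bool) :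
    bsnoc (Fin.init (α := fun _ => Bool) t) (t (Fin.last n)) = t :=
  Fin.snoc_init_self (α := fun _ => Bool) t

/-- A family indexed by `2^n` is a configuration if it maps the edges of the `n`-th finite
approximation of `𝔾₀` (given by the sequence `s`) to edges of `A`, through `w`. -/
def IsConf {X Z : Type*} (A : Set (X × X)) (w : Z → X) (s : ∀ n, Fin n → Bool) :
    ∀ n, ((Fin n → Bool) → Z) → Prop
  | 0, _ => True
  | n + 1, γ => IsConf A w s n (fun t => γ (bsnoc t false)) ∧
      IsConf A w s n (fun t => γ (bsnoc t true)) ∧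
      (w (γ (bsnoc (s n) false)), w (γ (bsnoc (s n) true))) ∈ A

theorem measurableSet_isConf {X Z : Type*} [MeasurableSpace X] [MeasurableSpace Z]
    {A : Set (X × X)} (hA : MeasurableSet A) {w : Z → X} (hw : Measurable w)
    (s : ∀ n, Fin n → Bool) (n : ℕ) : MeasurableSet {γ | IsConf A w s n γ} := by
  induction n with
  | zero => simp [IsConf]
  | succ n ih =>
    have hc : ∀ c : Bool, Measurable
        fun (γ : (Fin (n + 1) → Bool) → Z) (t : Fin n → Bool) => γ (bsnoc t c) := fun c =>
      measurable_pi_lambda _ fun t => measurable_pi_apply _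
    exact (hc false ih).inter ((hc true ih).inter
      (((hw.comp (measurable_pi_apply _)).prodMk (hw.comp (measurable_pi_apply _))) hA))

theorem IsConf.mem_of_lt {X Z : Type*} {A : Set (X × X)} {w : Z → X} {s : ∀ n, Fin n → Bool}
    {n : ℕ} {x : Cantor} (hx : cantorRes x n = s n) (hxn : x n = false) :
    ∀ {m : ℕ} {γ : (Fin m → Bool) → Z}, IsConf A w s m γ → n < m →
      (w (γ (cantorRes x m)), w (γ (cantorRes (Function.update x n true) m))) ∈ A := by
  have hup : cantorRes (Function.update x n true) n = cantorRes x n := by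
    ext i
    simp [cantorRes, i.2.ne]
  intro m
  induction m with
  | zero => intro γ _ h; exact absurd h (Nat.not_lt_zero _)
  | succ m ih =>
    intro γ hγ hnm
    simp only [cantorRes_succ]
    rcases (Nat.lt_succ_iff.1 hnm).eq_or_lt with rfl | hlt
    · simpa [hup, hx, hxn] using hγ.2.2
    · rw [Function.update_of_ne hlt.ne']
      cases x m with
      | false => exact ih hγ.1 hlt
      | true => exact ih hγ.2.1 hlt

/-- The family of sets `a'` indexed by `2^(n+1)` is a refinement of the family `a` indexed by
`2^n`, made of small sets, and separating the two endpoints of the edge added at level `n`. -/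
def IsRefinement {X Z : Type*} [MetricSpace Z] (w : Z → X) {n : ℕ} (s : Fin n → Bool)
    (a : (Fin n → Bool) → Set Z) (a' : (Fin (n + 1) → Bool) → Set Z) : Prop :=
  (∀ t c, a' (bsnoc t c) ⊆ a t) ∧ (∀ t, ∀ z ∈ a' t, ∀ z' ∈ a' t, dist z z' ≤ (1 / 2) ^ n) ∧
    ∀ z ∈ closure (a' (bsnoc s false)), ∀ z' ∈ closure (a' (bsnoc s true)), w z ≠ w z'

/-- If a configuration at level `n + 1` lies in open sets `a t`, then these have a refinement
containing it. -/
theorem exists_isRefinement {X Z : Type*} [TopologicalSpace X] [T2Space X] [RegularSpace X]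
    [MetricSpace Z] {w : Z → X} (hw : Continuous w) {b : Set (Set Z)} (hb : IsTopologicalBasis b)
    {n : ℕ} (s : Fin n → Bool) (a : (Fin n → Bool) → b) (γ : (Fin (n + 1) → Bool) → Z)
    (hγ : ∀ t c, γ (bsnoc t c) ∈ (a t : Set Z))
    (hne : w (γ (bsnoc s false)) ≠ w (γ (bsnoc s true))) :
    ∃ a' : (Fin (n + 1) → Bool) → b, IsRefinement w s (fun t => a t) (fun t => a' t) ∧
      ∀ t, γ t ∈ (a' t : Set Z) := by
  obtain ⟨O₀, h₀, hO₀, O₁, h₁, hO₁, hO⟩ := exists_open_nhds_disjoint_closure hne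
  have key : ∀ t : Fin (n + 1) → Bool, ∃ v ∈ b, γ t ∈ v ∧
      v ⊆ a (Fin.init (α := fun _ => Bool) t) ∩ Metric.ball (γ t) ((1 / 2) ^ n / 2) ∩
        ({z | t = bsnoc s false → w z ∈ O₀} ∩ {z | t = bsnoc s true → w z ∈ O₁}) := by
    intro t
    refine hb.exists_subset_of_mem_open ⟨⟨?_, Metric.mem_ball_self (by positivity)⟩, ?_, ?_⟩
      (((hb.isOpen (a _).2).inter Metric.isOpen_ball).inter (.inter ?_ ?_))
    · have := hγ (Fin.init (α := fun _ => Bool) t) (t (Fin.last n))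
      rwa [bsnoc_init] at this
    · rintro rfl; exact h₀
    · rintro rfl; exact h₁
    · by_cases h : t = bsnoc s false
      · simp only [h, forall_const]
        exact hO₀.preimage hw
      · simp [h]
    · by_cases h : t = bsnoc s true
      · simp only [h, forall_const]
        exact hO₁.preimage hw
      · simp [h]
  choose v hvb hγv hv using key
  refine ⟨fun t => ⟨v t, hvb t⟩, ⟨fun t c z hz => ?_, fun t z hz z' hz' => ?_,
    fun z hz z' hz' h => ?_⟩, hγv⟩
  · simpa [bsnoc, Fin.init_snoc] using (hv _ hz).1.1
  · have h₁ := Metric.mem_ball.1 (hv t hz).1.2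
    have h₂ := Metric.mem_ball.1 (hv t hz').1.2
    linarith [dist_triangle_right z z' (γ t)]
  · have h₂ : w z ∈ closure O₀ :=
      map_mem_closure hw hz fun y hy => (hv _ hy).2.1 rfl
    have h₃ : w z' ∈ closure O₁ :=
      map_mem_closure hw hz' fun y hy => (hv _ hy).2.2 rfl
    exact hO.le_bot ⟨h₂, h ▸ h₃⟩

/-- A decreasing scheme of refinements containing configurations induces a homomorphism. -/
theorem exists_hom_of_isRefinement {X Z : Type*} [TopologicalSpace X] [MetricSpace Z]
    [CompleteSpace Z] {A : Set (X × X)} (hA : closure A ⊆ A ∪ diagonal X) {w : Z → X}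
    (hw : Continuous w) (s : ∀ n, Fin n → Bool) (a : ∀ n, (Fin n → Bool) → Set Z)
    (ha : ∀ n, IsRefinement w (s n) (a n) (a (n + 1))) (γ : ∀ n, (Fin (n + 1) → Bool) → Z)
    (hγ : ∀ n, IsConf A w s (n + 1) (γ n)) (hγa : ∀ n t, γ n t ∈ a (n + 1) t) :
    ∃ φ : Cantor → Z, Continuous φ ∧ ∀ n x, cantorRes x n = s n → x n = false →
      (w (φ x), w (φ (Function.update x n true))) ∈ A := by
  have hanti : ∀ x, Antitone fun n => a n (cantorRes x n) := fun x =>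
    antitone_nat_of_succ_le fun n => by
      rw [cantorRes_succ]
      exact (ha n).1 _ _
  have hmem : ∀ x n m, n ≤ m → γ m (cantorRes x (m + 1)) ∈ a (n + 1) (cantorRes x (n + 1)) :=
    fun x n m h => hanti x (Nat.succ_le_succ h) (hγa m _)
  have hlim0 : Tendsto (fun n : ℕ => ((1 : ℝ) / 2) ^ n) atTop (𝓝 0) :=
    tendsto_pow_atTop_nhds_zero_of_lt_one (by norm_num) (by norm_num)
  have hcau : ∀ x, CauchySeq fun m => γ m (cantorRes x (m + 1)) := fun x =>
    cauchySeq_of_le_tendsto_0 (fun n : ℕ => ((1 : ℝ) / 2) ^ n)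
      (fun m k N hm hk => (ha N).2.1 _ _ (hmem x N m hm) _ (hmem x N k hk)) hlim0
  choose φ hφ using fun x => cauchySeq_tendsto_of_complete (hcau x)
  have hcl : ∀ x n, φ x ∈ closure (a (n + 1) (cantorRes x (n + 1))) := fun x n =>
    mem_closure_of_tendsto (hφ x) ((eventually_ge_atTop n).mono fun m hm => hmem x n m hm)
  have hdist : ∀ n t, ∀ z ∈ closure (a (n + 1) t), ∀ z' ∈ closure (a (n + 1) t),
      dist z z' ≤ (1 / 2) ^ n := by
    intro n t z hz z' hz'
    have h : (z, z') ∈ closure (a (n + 1) t ×ˢ a (n + 1) t) := by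
      rw [closure_prod_eq]
      exact ⟨hz, hz'⟩
    exact closure_minimal (s := a (n + 1) t ×ˢ a (n + 1) t)
      (t := {p : Z × Z | dist p.1 p.2 ≤ (1 / 2) ^ n})
      (fun p hp => (ha n).2.1 t _ hp.1 _ hp.2)
      (isClosed_le (by fun_prop) continuous_const) h
  refine ⟨φ, continuous_iff_continuousAt.2 fun x => Metric.tendsto_nhds.2 fun ε hε => ?_,
    fun n x hx hxn => ?_⟩
  · obtain ⟨n, hn⟩ := (hlim0.eventually_lt_const hε).exists
    have hev : ∀ᶠ y in 𝓝 x, cantorRes y (n + 1) = cantorRes x (n + 1) := by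
      have hc : Continuous fun y : Cantor => cantorRes y (n + 1) :=
        continuous_pi fun i => continuous_apply (i : ℕ)
      exact (hc.tendsto x).eventually (p := fun t => t = cantorRes x (n + 1))
        (by rw [nhds_discrete]; exact eventually_pure.2 rfl)
    filter_upwards [hev] with y hy
    exact (hdist n _ _ (hy ▸ hcl y n) _ (hcl x n)).trans_lt hn
  · set y := Function.update x n true with hy
    have hyn : cantorRes y n = s n := by
      rw [← hx]
      ext i
      simp [cantorRes, hy, i.2.ne]
    have hyt : y n = true := by simp [hy]
    have hmemA : (w (φ x), w (φ y)) ∈ closure A := by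
      refine mem_closure_of_tendsto ((((hw.tendsto _).comp (hφ x))).prodMk_nhds
        ((hw.tendsto _).comp (hφ y))) ((eventually_ge_atTop n).mono fun m hm => ?_)
      exact (hγ m).mem_of_lt hx hxn (Nat.lt_succ_iff.2 hm)
    refine (hA hmemA).resolve_right fun h => ?_
    have h₁ := hcl x n
    have h₂ := hcl y n
    rw [cantorRes_succ, hx, hxn] at h₁
    rw [cantorRes_succ, hyn, hyt] at h₂
    exact (ha n).2.2 _ h₁ _ h₂ h

theorem ContinuousOn.measurableSet_inter_preimage_of_measurableSet {X Y : Type*} [TopologicalSpace X]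
    [MeasurableSpace X] [BorelSpace X] [TopologicalSpace Y] [MeasurableSpace Y] [BorelSpace Y]
    {D : Set X} {f : X → Y} (hf : ContinuousOn f D) (hD : MeasurableSet D) {B : Set Y}
    (hB : MeasurableSet B) : MeasurableSet (D ∩ f ⁻¹' B) := by
  have h := hD.subtype_image ((continuousOn_iff_continuous_domRestrict.1 hf).measurable hB)
  convert! h using 1
  ext x
  simp [and_comm]

/-- An analytic independent set is contained in a Borel independent set. -/
theorem IsIndep.exists_measurableSet {X : Type} [TopologicalSpace X] [PolishSpace X]
    [MeasurableSpace X] [BorelSpace X] {D : ℕ → Set X} {f : ℕ → X → X}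
    (hD : ∀ n, MeasurableSet (D n)) (hf : ∀ n, ContinuousOn (f n) (D n)) {S : Set X}
    (hS : AnalyticSet S) (h : IsIndep (unionGraphs D f) S) :
    ∃ B, S ⊆ B ∧ MeasurableSet B ∧ IsIndep (unionGraphs D f) B := by
  have hSD : ∀ n, AnalyticSet (S ∩ D n) := fun n => by
    rw [inter_eq_iInter]
    exact AnalyticSet.iInter fun c => by cases c <;> [exact (hD n).analyticSet; exact hS]
  have hN : AnalyticSet (⋃ n, f n '' (S ∩ D n)) := AnalyticSet.iUnion fun n =>
    (hSD n).image_of_continuousOn ((hf n).mono inter_subset_right)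
  have hdisj : Disjoint S (⋃ n, f n '' (S ∩ D n)) := by
    refine disjoint_left.2 fun y hy hy' => ?_
    obtain ⟨n, x, ⟨hx, hxD⟩, rfl⟩ := mem_iUnion.1 hy'
    exact h x hx _ hy (mem_unionGraphs.2 ⟨n, hxD, rfl⟩)
  obtain ⟨B, hSB, hB, hBm⟩ := hS.measurablySeparable hN hdisj
  refine ⟨B \ ⋃ n, D n ∩ f n ⁻¹' B, fun x hx => ⟨hSB hx, fun hx' => ?_⟩,
    hBm.diff (.iUnion fun n => (hf n).measurableSet_inter_preimage_of_measurableSet (hD n) hBm),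
    fun x hx y hy hxy => ?_⟩
  · obtain ⟨n, hxD, hxB⟩ := mem_iUnion.1 hx'
    exact disjoint_left.1 hB (mem_iUnion.2 ⟨n, mem_image_of_mem _ ⟨hx, hxD⟩⟩) hxB
  · obtain ⟨n, hxD, rfl⟩ := mem_unionGraphs.1 hxy
    exact hx.2 (mem_iUnion.2 ⟨n, hxD, hy.1⟩)

/-- `E` is covered by countably many Borel independent sets. -/
def IsCountablyIndep {X : Type*} [MeasurableSpace X] (A : Set (X × X)) (E : Set X) : Prop :=
  ∃ B : ℕ → Set X, (∀ k, MeasurableSet (B k) ∧ IsIndep A (B k)) ∧ E ⊆ ⋃ k, B k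

theorem IsIndep.isCountablyIndep {X : Type*} [MeasurableSpace X] {A : Set (X × X)} {E : Set X}
    (h : IsIndep A E) (hE : MeasurableSet E) : IsCountablyIndep A E :=
  ⟨fun _ => E, fun _ => ⟨hE, h⟩, subset_iUnion (fun _ : ℕ => E) 0⟩

theorem IsCountablyIndep.mono {X : Type*} [MeasurableSpace X] {A : Set (X × X)} {E F : Set X}
    (h : IsCountablyIndep A F) (hEF : E ⊆ F) : IsCountablyIndep A E :=
  let ⟨B, hB, hFB⟩ := h
  ⟨B, hB, hEF.trans hFB⟩

theorem isCountablyIndep_iUnion {X ι : Type*} [MeasurableSpace X] [Countable ι]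
    {A : Set (X × X)} {E : ι → Set X} (h : ∀ i, IsCountablyIndep A (E i)) :
    IsCountablyIndep A (⋃ i, E i) := by
  rcases isEmpty_or_nonempty ι with hι | hι
  · exact ⟨fun _ => ∅, fun _ => ⟨.empty, fun x hx => hx.elim⟩, by simp⟩
  choose B hB hEB using h
  obtain ⟨e, he⟩ := exists_surjective_nat (ι × ℕ)
  refine ⟨fun k => B (e k).1 (e k).2, fun k => hB _ _, iUnion_subset fun i x hx => ?_⟩
  obtain ⟨n, hn⟩ := mem_iUnion.1 (hEB i hx)
  obtain ⟨k, hk⟩ := he (i, n)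
  exact mem_iUnion.2 ⟨k, by rwa [hk]⟩

/-- A version of the `𝔾₀`-dichotomy: if the range of `w` is not a countable union of Borel
independent sets, then there is a continuous map to the domain of `w` inducing a homomorphism
from `𝔾₀` to `A`. -/
theorem exists_hom_of_not_isCountablyIndep {X Z : Type*} [TopologicalSpace X] [T2Space X]
    [RegularSpace X] [MeasurableSpace X] [OpensMeasurableSpace X] [SecondCountableTopology X]
    [BorelSpace X] [TopologicalSpace Z]
    [PolishSpace Z] {A : Set (X × X)} (hA : closure A ⊆ A ∪ diagonal X)
    (hAm : MeasurableSet A) (hirr : ∀ x, (x, x) ∉ A)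
    (hsep : ∀ S, AnalyticSet S → IsIndep A S → ∃ B, S ⊆ B ∧ MeasurableSet B ∧ IsIndep A B)
    {w : Z → X} (hw : Continuous w) (s : ∀ n, Fin n → Bool)
    (hr : ¬ IsCountablyIndep A (range w)) :
    ∃ φ : Cantor → Z, Continuous φ ∧ ∀ n x, cantorRes x n = s n → x n = false →
      (w (φ x), w (φ (Function.update x n true))) ∈ A := by
  classical
  let _ := upgradeIsCompletelyMetrizable Z
  let _ : MeasurableSpace Z := borel Z
  have : BorelSpace Z := ⟨rfl⟩
  obtain ⟨b, hbc, -, hb⟩ := exists_countable_basis Z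
  have := hbc.to_subtype
  let Comp (n : ℕ) (a : (Fin n → Bool) → b) (Y : Set X) (γ : (Fin n → Bool) → Z) : Prop :=
    IsConf A w s n γ ∧ ∀ t, γ t ∈ (a t : Set Z) ∧ w (γ t) ∈ Y
  let Term (i : Σ n, (Fin n → Bool) → b) (Y : Set X) : Prop :=
    ∀ a' : (Fin (i.1 + 1) → Bool) → b,
      IsRefinement w (s i.1) (fun t => (i.2 t : Set Z)) (fun t => a' t) →
      ∀ γ, ¬ Comp (i.1 + 1) a' Y γ
  have hTermY : ∀ i, ∃ Y : Set X, MeasurableSet Y ∧ IsCountablyIndep A Yᶜ ∧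
      ((∃ Y', MeasurableSet Y' ∧ IsCountablyIndep A Y'ᶜ ∧ Term i Y') → Term i Y) := by
    intro i
    by_cases h : ∃ Y', MeasurableSet Y' ∧ IsCountablyIndep A Y'ᶜ ∧ Term i Y'
    · obtain ⟨Y, h₁, h₂, h₃⟩ := h
      exact ⟨Y, h₁, h₂, fun _ => h₃⟩
    · refine ⟨univ, .univ, ?_, fun h' => absurd h' h⟩
      rw [compl_univ]
      exact IsIndep.isCountablyIndep (fun x hx => hx.elim) .empty
  choose Y hYm hYc hYT using hTermY
  set Y₀ := ⋂ i, Y i with hY₀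
  have hY₀m : MeasurableSet Y₀ := .iInter hYm
  have hY₀c : IsCountablyIndep A Y₀ᶜ := by
    rw [hY₀, compl_iInter]
    exact isCountablyIndep_iUnion hYc
  let AS (i : Σ n, (Fin n → Bool) → b) : Set X := (fun γ => w (γ (s i.1))) '' {γ | Comp i.1 i.2 Y₀ γ}
  have hB : ∀ i, ∃ B, MeasurableSet B ∧ IsIndep A B ∧ (Term i (Y i) → AS i ⊆ B) := by
    rintro ⟨n, a⟩
    by_cases hT : Term ⟨n, a⟩ (Y ⟨n, a⟩)
    swap
    · exact ⟨∅, .empty, fun x hx => hx.elim, fun h => absurd h hT⟩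
    have han : AnalyticSet (AS ⟨n, a⟩) := by
      refine MeasurableSet.analyticSet_image ?_ (hw.comp (continuous_apply _)).measurable
      have h₁ : MeasurableSet {γ : (Fin n → Bool) → Z | ∀ t, γ t ∈ (a t : Set Z) ∧ w (γ t) ∈ Y₀} := by
        rw [ofPred_forall]
        exact .iInter fun t => ((measurable_pi_apply t) (hb.isOpen (a t).2).measurableSet).inter
          ((hw.measurable.comp (measurable_pi_apply t)) hY₀m)
      exact (measurableSet_isConf hAm hw.measurable s n).inter h₁
    have hind : IsIndep A (AS ⟨n, a⟩) := by
      rintro _ ⟨γ, hγ, rfl⟩ _ ⟨γ', hγ', rfl⟩ hA'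
      let δ : (Fin (n + 1) → Bool) → Z := fun t =>
        if t (Fin.last n) then γ' (Fin.init (α := fun _ => Bool) t)
        else γ (Fin.init (α := fun _ => Bool) t)
      have hδ₀ : ∀ t, δ (bsnoc t false) = γ t := fun t => by simp [δ, bsnoc]
      have hδ₁ : ∀ t, δ (bsnoc t true) = γ' t := fun t => by simp [δ, bsnoc]
      have hδ : ∀ t c, δ (bsnoc t c) ∈ (a t : Set Z) ∧ w (δ (bsnoc t c)) ∈ Y₀ := by
        rintro t (_ | _)
        · rw [hδ₀]; exact hγ.2 t
        · rw [hδ₁]; exact hγ'.2 t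
      have hconf : IsConf A w s (n + 1) δ := by
        refine ⟨?_, ?_, ?_⟩
        · simpa only [hδ₀] using hγ.1
        · simpa only [hδ₁] using hγ'.1
        · simpa only [hδ₀, hδ₁] using hA'
      obtain ⟨a', ha', hδa'⟩ := exists_isRefinement hw hb (s n) a δ (fun t c => (hδ t c).1)
        (fun h => hirr _ (h ▸ hconf.2.2))
      refine hT a' ha' δ ⟨hconf, fun t => ⟨hδa' t, ?_⟩⟩
      have := (hδ (Fin.init (α := fun _ => Bool) t) (t (Fin.last n))).2
      rw [bsnoc_init] at this
      exact mem_iInter.1 this _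
    obtain ⟨B, h₁, h₂, h₃⟩ := hsep _ han hind
    exact ⟨B, h₂, h₃, fun _ => h₁⟩
  choose B hBm hBi hAB using hB
  set Y₁ := Y₀ \ ⋃ i, B i with hY₁
  have hY₁m : MeasurableSet Y₁ := hY₀m.diff (.iUnion hBm)
  have hcov : IsCountablyIndep A (Y₀ᶜ ∪ ⋃ i, B i) := by
    rw [union_eq_iUnion]
    refine isCountablyIndep_iUnion fun c => ?_
    cases c
    · exact isCountablyIndep_iUnion fun i => (hBi i).isCountablyIndep (hBm i)
    · exact hY₀c
  have hY₁c : IsCountablyIndep A Y₁ᶜ := hcov.mono fun x hx => by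
    by_cases h : x ∈ Y₀
    · exact Or.inr (by_contra fun h' => hx ⟨h, h'⟩)
    · exact Or.inl h
  have hstep : ∀ n (a : (Fin n → Bool) → b), ¬ Term ⟨n, a⟩ (Y ⟨n, a⟩) →
      ∃ a' : (Fin (n + 1) → Bool) → b, ¬ Term ⟨n + 1, a'⟩ (Y ⟨n + 1, a'⟩) ∧
        IsRefinement w (s n) (fun t => (a t : Set Z)) (fun t => a' t) ∧
        ∃ γ, IsConf A w s (n + 1) γ ∧ ∀ t, γ t ∈ (a' t : Set Z) := by
    intro n a ha
    have h : ¬ Term ⟨n, a⟩ Y₁ := fun h => ha (hYT _ ⟨Y₁, hY₁m, hY₁c, h⟩)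
    simp only [Term, not_forall, not_not] at h
    obtain ⟨a', ha', γ, hγ⟩ := h
    refine ⟨a', fun hT => ?_, ha', γ, hγ.1, fun t => (hγ.2 t).1⟩
    refine (hγ.2 (s (n + 1))).2.2 (mem_iUnion.2 ⟨⟨n + 1, a'⟩, hAB _ hT ⟨γ, ⟨hγ.1, fun t =>
      ⟨(hγ.2 t).1, (hγ.2 t).2.1⟩⟩, rfl⟩⟩)
  have hzero : ∃ a : (Fin 0 → Bool) → b, ¬ Term ⟨0, a⟩ (Y ⟨0, a⟩) := by
    by_contra! h
    refine hr (hcov.mono ?_)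
    rintro _ ⟨z, rfl⟩
    by_cases hz : w z ∈ Y₀
    · obtain ⟨v, hv, hzv, -⟩ := hb.exists_subset_of_mem_open (mem_univ z) isOpen_univ
      exact Or.inr (mem_iUnion.2 ⟨⟨0, fun _ => ⟨v, hv⟩⟩,
        hAB _ (h _) ⟨fun _ => z, ⟨trivial, fun _ => ⟨hzv, hz⟩⟩, rfl⟩⟩)
    · exact Or.inl hz
  choose N hN hNr hNγ using hstep
  obtain ⟨a₀, ha₀⟩ := hzero
  let a : ∀ n, {a : (Fin n → Bool) → b // ¬ Term ⟨n, a⟩ (Y ⟨n, a⟩)} := fun n =>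
    Nat.rec ⟨a₀, ha₀⟩ (fun n a => ⟨N n a.1 a.2, hN n a.1 a.2⟩) n
  choose γ hγ hγa using fun n => hNγ n (a n).1 (a n).2
  exact exists_hom_of_isRefinement hA hw s (fun n t => (a n).1 t)
    (fun n => hNr n (a n).1 (a n).2) γ hγ hγa

theorem exists_cantorRes_subset {V : Set Cantor} (hV : IsOpen V) {x : Cantor} (hx : x ∈ V) :
    ∃ m, {y | cantorRes y m = cantorRes x m} ⊆ V := by
  obtain ⟨_, ⟨y, m, rfl⟩, hxy, hV⟩ :=
    (PiNat.isTopologicalBasis_cylinders fun _ => Bool).exists_subset_of_mem_open hx hV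
  refine ⟨m, fun z hz => hV ?_⟩
  rw [PiNat.mem_cylinder_iff] at hxy ⊢
  intro i hi
  exact (congrFun hz ⟨i, hi⟩).trans (hxy i hi)

theorem continuous_cantorRes (n : ℕ) : Continuous fun y : Cantor => cantorRes y n :=
  continuous_pi fun i => continuous_apply (i : ℕ)

theorem isClopen_cantorRes (n : ℕ) (t : Fin n → Bool) : IsClopen {x | cantorRes x n = t} :=
  (isClopen_discrete {t}).preimage (continuous_cantorRes n)

theorem exists_dense_cantorRes : ∃ s : ∀ n, Fin n → Bool, ∀ V : Set Cantor, IsOpen V →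
    V.Nonempty → ∃ n, {x | cantorRes x n = s n} ⊆ V := by
  refine ⟨fun n => cantorRes (denseSeq Cantor n.unpair.1) n, fun V hV hne => ?_⟩
  obtain ⟨_, hx, k, rfl⟩ := (denseRange_denseSeq Cantor).inter_open_nonempty V hV hne
  obtain ⟨m, hm⟩ := exists_cantorRes_subset hV hx
  refine ⟨Nat.pair k m, fun x hx => hm ?_⟩
  ext i
  simpa [cantorRes] using congrFun hx ⟨i, i.2.trans_le (Nat.right_le_pair k m)⟩

/-- The homeomorphism of the Cantor space changing the `n`-th coordinate. -/
def cantorFlip (n : ℕ) : Cantor ≃ₜ Cantor where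
  toFun x := Function.update x n (!x n)
  invFun x := Function.update x n (!x n)
  left_inv x := by simp
  right_inv x := by simp
  continuous_toFun :=
    continuous_id.update n ((continuous_of_discreteTopology (f := not)).comp (continuous_apply n))
  continuous_invFun :=
    continuous_id.update n ((continuous_of_discreteTopology (f := not)).comp (continuous_apply n))

theorem exists_mem_of_not_isMeagre {X : Type*} {A : Set (X × X)} {s : ∀ n, Fin n → Bool}
    (hs : ∀ V : Set Cantor, IsOpen V → V.Nonempty → ∃ n, {x | cantorRes x n = s n} ⊆ V)
    {ψ : Cantor → X} (hψ : ∀ n x, cantorRes x n = s n → x n = false →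
      (ψ x, ψ (Function.update x n true)) ∈ A)
    {E : Set X} (hE : MeasurableSet (ψ ⁻¹' E)) (hE' : ¬ IsMeagre (ψ ⁻¹' E)) :
    ∃ x ∈ E, ∃ y ∈ E, (x, y) ∈ A := by
  obtain ⟨V, hVo, hV⟩ := hE.residualEq_isOpen
  have hVne : V.Nonempty := by
    by_contra h
    rw [not_nonempty_iff_eq_empty] at h
    subst h
    exact hE' (by filter_upwards [hV.mem_iff] with x hx using fun h => hx.1 h)
  obtain ⟨n, hn⟩ := hs V hVo hVne
  have hflip : ∀ᶠ x in residual Cantor, (cantorFlip n x ∈ ψ ⁻¹' E ↔ cantorFlip n x ∈ V) :=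
    (tendsto_residual_of_isOpenMap (cantorFlip n).continuous (cantorFlip n).isOpenMap).eventually
      hV.mem_iff
  have h0 : IsOpen ((fun x : Cantor => x n) ⁻¹' {false}) :=
    (isOpen_discrete {false}).preimage (continuous_apply n)
  have hU : IsOpen {x : Cantor | cantorRes x n = s n ∧ x n = false} :=
    (isClopen_cantorRes n _).isOpen.inter h0
  obtain ⟨x, ⟨hxn, hx0⟩, hx, hx'⟩ := (dense_of_mem_residual (hV.mem_iff.and hflip)).inter_open_nonempty
    _ hU ⟨fun i => if h : i < n then s n ⟨i, h⟩ else false, by ext i; simp [cantorRes], by simp⟩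
  have hfx : cantorFlip n x = Function.update x n true := by simp [cantorFlip, hx0]
  rw [hfx] at hx'
  refine ⟨ψ x, hx.2 (hn hxn), _, hx'.2 (hn ?_), hψ n x hxn hx0⟩
  rw [mem_ofPred_eq, ← hxn]
  ext i
  simp [cantorRes, i.2.ne]

/-- The initial segments of the lexicographically least preimage of a point under `ψ`. -/
noncomputable def leastRes {X : Type*} (ψ : Cantor → X) (y : X) : ∀ n, Fin n → Bool
  | 0 => Fin.elim0
  | n + 1 =>
    letI := Classical.dec (y ∈ ψ '' {x | cantorRes x (n + 1) = bsnoc (leastRes ψ y n) false})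
    bsnoc (leastRes ψ y n)
      (!decide (y ∈ ψ '' {x | cantorRes x (n + 1) = bsnoc (leastRes ψ y n) false}))

/-- A continuous map from the Cantor space to a Hausdorff space has a Borel section. -/
theorem exists_measurable_section {X : Type*} [TopologicalSpace X] [T2Space X]
    [MeasurableSpace X] [BorelSpace X] {ψ : Cantor → X} (hψ : Continuous ψ) :
    ∃ σ : X → Cantor, (∀ n, MeasurableSet {y | σ y n = true}) ∧ ∀ y ∈ range ψ, ψ (σ y) = y := by
  classical
  let σ : X → Cantor := fun y n => leastRes ψ y (n + 1) (Fin.last n)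
  have hσ : ∀ y n, σ y n = true ↔
      y ∉ ψ '' {x | cantorRes x (n + 1) = bsnoc (leastRes ψ y n) false} := by
    intro y n
    simp [σ, leastRes, bsnoc]
  have hsucc : ∀ y n, leastRes ψ y (n + 1) = bsnoc (leastRes ψ y n) (σ y n) := by
    intro y n
    simp [σ, leastRes, bsnoc]
  have hres : ∀ y n, cantorRes (σ y) n = leastRes ψ y n := by
    intro y n
    induction n with
    | zero => exact Subsingleton.elim _ _
    | succ n ih => rw [cantorRes_succ, hsucc, ih]
  have himg : ∀ n t, MeasurableSet (ψ '' {x | cantorRes x n = t}) := fun n t =>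
    ((isClopen_cantorRes n t).isClosed.isCompact.image hψ).isClosed.measurableSet
  have hbit : ∀ n, (∀ t, MeasurableSet {y | leastRes ψ y n = t}) →
      MeasurableSet {y | σ y n = true} := by
    intro n hn
    have : {y | σ y n = true} = ⋃ t, {y | leastRes ψ y n = t} ∩
        (ψ '' {x | cantorRes x (n + 1) = bsnoc t false})ᶜ := by
      ext y
      rw [mem_ofPred_eq, hσ]
      simp
    rw [this]
    exact .iUnion fun t => (hn t).inter (himg _ _).compl
  have hmeas : ∀ n t, MeasurableSet {y | leastRes ψ y n = t} := by
    intro n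
    induction n with
    | zero => exact fun t => by simp [Subsingleton.elim _ t]
    | succ n ih =>
      intro t
      have : {y | leastRes ψ y (n + 1) = t} =
          {y | leastRes ψ y n = Fin.init (α := fun _ => Bool) t} ∩
            {y | σ y n = t (Fin.last n)} := by
        ext y
        rw [mem_ofPred_eq, hsucc]
        constructor
        · rintro rfl
          simp [bsnoc]
        · rintro ⟨h₁, h₂⟩
          rw [mem_ofPred_eq] at h₁ h₂
          rw [h₁, h₂, bsnoc_init]
      rw [this]
      refine (ih _).inter ?_
      cases t (Fin.last n)
      · convert! (hbit n ih).compl using 1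
        ext y
        simp
      · exact hbit n ih
  refine ⟨σ, fun n => hbit n (hmeas n), fun y hy => ?_⟩
  have hmem : ∀ n, y ∈ ψ '' {x | cantorRes x n = leastRes ψ y n} := by
    intro n
    induction n with
    | zero =>
      obtain ⟨x, rfl⟩ := hy
      exact ⟨x, Subsingleton.elim _ _, rfl⟩
    | succ n ih =>
      obtain ⟨x, hx, hxy⟩ := ih
      rw [hsucc]
      by_cases h : y ∈ ψ '' {x | cantorRes x (n + 1) = bsnoc (leastRes ψ y n) false}
      · have : σ y n = false := by rw [← Bool.not_eq_true, hσ]; exact not_not.2 h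
        rwa [this]
      · have h' := (hσ y n).2 h
        rw [h']
        refine ⟨x, ?_, hxy⟩
        rw [mem_ofPred_eq, cantorRes_succ, hx]
        cases hb : x n
        · exact absurd ⟨x, by rw [mem_ofPred_eq, cantorRes_succ, hx, hb], hxy⟩ h
        · rfl
  by_contra hne
  obtain ⟨m, hm⟩ := exists_cantorRes_subset (isOpen_ne.preimage hψ : IsOpen {x | ψ x ≠ y}) hne
  obtain ⟨x, hx, hxy⟩ := hmem m
  exact hm (by rw [mem_ofPred_eq, hres]; exact hx) hxy

theorem subF_val {X : Type} {B : Set X} {f : X → X} {x : B} (h : f x ∈ B) :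
    (subF B f x : X) = f x := by
  simp [subF, h]

theorem mem_restrGraphs {X : Type} {B : Set X} {D : ℕ → Set X} {f : ℕ → X → X} {x y : B} :
    (x, y) ∈ restrGraphs B D f ↔ ((x : X), (y : X)) ∈ unionGraphs D f := by
  rw [restrGraphs, mem_unionGraphs, mem_unionGraphs]
  refine exists_congr fun n => ⟨fun ⟨⟨h₁, h₂⟩, h⟩ => ⟨h₁, by rw [h, subF_val h₂]⟩, fun ⟨h₁, h⟩ => ?_⟩
  have h₂ : f n x ∈ B := h ▸ y.2
  exact ⟨⟨h₁, h₂⟩, Subtype.ext (by rw [h, subF_val h₂])⟩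

theorem continuousOn_subF {X : Type} [TopologicalSpace X] {B D : Set X} {f : X → X}
    (hf : ContinuousOn f D) : ContinuousOn (subF B f) (subD B D f) := by
  rw [Topology.IsInducing.subtypeVal.continuousOn_iff]
  exact (hf.comp continuous_subtype_val.continuousOn fun x hx => hx.1).congr
    fun x hx => subF_val hx.2

theorem image_subF {X : Type} {B D : Set X} {f g : X → X} (hg : ∀ x ∈ D, g (f x) = x) :
    subF B f '' subD B D f = subD B (f '' D) g := by
  ext y
  constructor
  · rintro ⟨x, ⟨hxD, hxB⟩, rfl⟩
    rw [subD, mem_ofPred_eq, subF_val hxB, hg x hxD]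
    exact ⟨mem_image_of_mem f hxD, x.2⟩
  · rintro ⟨⟨x, hxD, hxy⟩, hy⟩
    rw [← hxy, hg x hxD] at hy
    have hfx : f x ∈ B := hxy ▸ y.2
    exact ⟨⟨x, hy⟩, ⟨hxD, hfx⟩, Subtype.ext (by rw [subF_val hfx, hxy])⟩

theorem isPartialHomeo_subF {X : Type} [TopologicalSpace X] {B D : Set X} {f g : X → X}
    (hf : ContinuousOn f D) (hg : ContinuousOn g (f '' D)) (hgf : ∀ x ∈ D, g (f x) = x)
    (hD : IsClopen (subD B D f)) (hR : IsClopen (subD B (f '' D) g)) :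
    IsPartialHomeo instTopologicalSpaceSubtype (subD B D f) (subF B f) := by
  refine ⟨hD, by rwa [image_subF hgf], continuousOn_subF hf, subF B g, ?_, fun x hx => ?_⟩
  · rw [image_subF hgf]
    exact continuousOn_subF hg
  · have h : subF B f x ∈ subD B (f '' D) g := image_subF hgf ▸ mem_image_of_mem _ hx
    refine Subtype.ext ?_
    rw [subF_val h.2, subF_val hx.2, hgf x hx.1]

/-- A sufficient condition for the restriction to a closed set to be a converging situation. -/
theorem convSit_subtype {X : Type} [TopologicalSpace X] [PolishSpace X]
    (hb : IsTopologicalBasis {s : Set X | IsClopen s}) {D : ℕ → Set X} {f : ℕ → X → X}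
    (hA : closure (unionGraphs D f) ⊆ unionGraphs D f ∪ diagonal X)
    (hirr : ∀ x, (x, x) ∉ unionGraphs D f) {C : Set X} (hC : IsClosed C) (hne : C.Nonempty)
    (hf : ∀ n, IsPartialHomeo instTopologicalSpaceSubtype (subD C (D n) (f n)) (subF C (f n)))
    (hedge : ∀ O, IsOpen O → (O ∩ C).Nonempty →
      ∃ x ∈ O ∩ C, ∃ y ∈ O ∩ C, (x, y) ∈ unionGraphs D f) :
    ConvSit C instTopologicalSpaceSubtype (fun n => subD C (D n) (f n))
      (fun n => subF C (f n)) := by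
  refine ⟨hne.to_subtype, hC.polishSpace, ?_, ⟨isClosed_univ, fun x _ => ?_⟩, hf, ?_⟩
  · refine isTopologicalBasis_of_isOpen_of_nhds (fun s hs => hs.isOpen) fun x U hx hU => ?_
    obtain ⟨O, hO, rfl⟩ := isOpen_induced_iff.1 hU
    obtain ⟨s, hs, hxs, hsO⟩ := hb.exists_subset_of_mem_open hx hO
    exact ⟨_, hs.preimage continuous_subtype_val, hxs, preimage_mono hsO⟩
  · rw [accPt_iff_nhds]
    intro U hU
    obtain ⟨V, hVU, hV, hxV⟩ := mem_nhds_iff.1 hU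
    obtain ⟨O, hO, rfl⟩ := isOpen_induced_iff.1 hV
    obtain ⟨y, hy, z, hz, hyz⟩ := hedge O hO ⟨x, hxV, x.2⟩
    by_cases h : y = x
    · refine ⟨⟨z, hz.2⟩, ⟨hVU hz.1, mem_univ _⟩, fun h' => hirr x ?_⟩
      rw [h, show z = x from congrArg Subtype.val h'] at hyz
      exact hyz
    · exact ⟨⟨y, hy.2⟩, ⟨hVU hy.1, mem_univ _⟩, fun h' => h (congrArg Subtype.val h')⟩
  · change diagonal C = closure (restrGraphs C D f) \ restrGraphs C D f
    ext ⟨x, y⟩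
    rw [mem_diagonal_iff, Set.mem_sdiff, mem_restrGraphs]
    constructor
    · rintro (h : x = y)
      subst h
      refine ⟨mem_closure_iff.2 fun U hU hxU => ?_, hirr x⟩
      obtain ⟨U₁, U₂, h₁, h₂, hx₁, hx₂, hU⟩ := isOpen_prod_iff.1 hU x x hxU
      obtain ⟨O, hO, hOU⟩ := isOpen_induced_iff.1 (h₁.inter h₂)
      obtain ⟨y, hy, z, hz, hyz⟩ := hedge O hO
        ⟨x, (show x ∈ Subtype.val ⁻¹' O from hOU ▸ ⟨hx₁, hx₂⟩), x.2⟩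
      have hy' : (⟨y, hy.2⟩ : C) ∈ U₁ ∩ U₂ := hOU ▸ hy.1
      have hz' : (⟨z, hz.2⟩ : C) ∈ U₁ ∩ U₂ := hOU ▸ hz.1
      exact ⟨(⟨y, hy.2⟩, ⟨z, hz.2⟩), hU ⟨hy'.1, hz'.2⟩, mem_restrGraphs.2 hyz⟩
    · rintro ⟨h₁, h₂⟩
      have h : ((x : X), (y : X)) ∈ closure (unionGraphs D f) :=
        map_mem_closure (f := Prod.map (Subtype.val : C → X) (Subtype.val : C → X))
          (by fun_prop) h₁ fun p hp => mem_restrGraphs.1 hp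
      exact Subtype.ext ((hA h).resolve_left h₂)

/-- Countable chain condition: up to a meagre set, there is a largest preimage by `F` of a Borel
set whose preimage by `ψ` is meagre. -/
theorem exists_isMeagre_preimage_diff {Y X : Type*} [TopologicalSpace Y] [BaireSpace Y]
    [SecondCountableTopology Y] [MeasurableSpace Y] [BorelSpace Y] [MeasurableSpace X]
    {ψ : Y → X} (hψ : Measurable ψ) {D : Set X} {F : X → X}
    (hF : ∀ E, MeasurableSet E → MeasurableSet (D ∩ F ⁻¹' E)) :
    ∃ E₀, MeasurableSet E₀ ∧ IsMeagre (ψ ⁻¹' E₀) ∧ ∀ E, MeasurableSet E → IsMeagre (ψ ⁻¹' E) →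
      IsMeagre (ψ ⁻¹' (D ∩ F ⁻¹' (E \ E₀))) := by
  obtain ⟨b, hbc, hb₀, hb⟩ := exists_countable_basis Y
  have := hbc.to_subtype
  have hV : ∀ V : b, ∃ E, MeasurableSet E ∧ IsMeagre (ψ ⁻¹' E) ∧
      ((∃ E', MeasurableSet E' ∧ IsMeagre (ψ ⁻¹' E') ∧
        IsMeagre ((V : Set Y) \ ψ ⁻¹' (D ∩ F ⁻¹' E'))) →
        IsMeagre ((V : Set Y) \ ψ ⁻¹' (D ∩ F ⁻¹' E))) := by
    intro V
    by_cases h : ∃ E', MeasurableSet E' ∧ IsMeagre (ψ ⁻¹' E') ∧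
        IsMeagre ((V : Set Y) \ ψ ⁻¹' (D ∩ F ⁻¹' E'))
    · obtain ⟨E, h₁, h₂, h₃⟩ := h
      exact ⟨E, h₁, h₂, fun _ => h₃⟩
    · exact ⟨∅, .empty, IsMeagre.empty, fun h' => absurd h' h⟩
  choose E hEm hEI hE using hV
  refine ⟨⋃ V, E V, .iUnion hEm, ?_, fun E' hE'm hE'I => ?_⟩
  · rw [preimage_iUnion]
    exact isMeagre_iUnion hEI
  have hQ : MeasurableSet (ψ ⁻¹' (D ∩ F ⁻¹' (E' \ ⋃ V, E V))) :=
    hψ (hF _ (hE'm.diff (.iUnion hEm)))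
  obtain ⟨W, hW, hQW⟩ := hQ.residualEq_isOpen
  rcases W.eq_empty_or_nonempty with rfl | ⟨y, hy⟩
  · exact Filter.mem_of_superset hQW.mem_iff fun x hx h => hx.1 h
  obtain ⟨V, hV, hyV, hVW⟩ := hb.exists_subset_of_mem_open hy hW
  have h₁ : IsMeagre (V \ ψ ⁻¹' (D ∩ F ⁻¹' E')) :=
    Filter.mem_of_superset hQW.mem_iff fun x hx h =>
      h.2 ⟨(hx.2 (hVW h.1)).1, (hx.2 (hVW h.1)).2.1⟩
  have h₂ := hE ⟨V, hV⟩ ⟨E', hE'm, hE'I, h₁⟩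
  refine absurd ?_ (not_isMeagre_of_isOpen (hb.isOpen hV) ⟨y, hyV⟩)
  refine Filter.mem_of_superset (Filter.inter_mem hQW.mem_iff h₂) fun x ⟨hx₁, hx₂⟩ hxV => ?_
  have h₃ := hx₁.2 (hVW hxV)
  refine hx₂ ⟨hxV, fun h₄ => h₃.2.2 (mem_iUnion.2 ⟨_, h₄.2⟩)⟩

theorem ConvSit.closure_subset {X : Type} [t : TopologicalSpace X] {D : ℕ → Set X}
    {f : ℕ → X → X} (h : ConvSit X t D f) :
    closure (unionGraphs D f) ⊆ unionGraphs D f ∪ diagonal X := fun _ hp =>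
  or_iff_not_imp_left.2 fun h' => h.2.2.2.2.2 ▸ ⟨hp, h'⟩

theorem ConvSit.irrefl {X : Type} [t : TopologicalSpace X] {D : ℕ → Set X} {f : ℕ → X → X}
    (h : ConvSit X t D f) (x : X) : (x, x) ∉ unionGraphs D f := by
  have hx : (x, x) ∈ diagonal X := mem_diagonal x
  rw [h.2.2.2.2.2] at hx
  exact hx.2

/-- A clopen set `B` which is large with respect to `ψ`, and on which the partial
homeomorphisms preserve small sets, contains a closed set giving rise to a converging
situation. -/
theorem exists_convSit_subset_of_isMeagre {X : Type} [TopologicalSpace X] [PolishSpace X]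
    [MeasurableSpace X] [BorelSpace X] (hb : IsTopologicalBasis {s : Set X | IsClopen s})
    {D : ℕ → Set X} {f g : ℕ → X → X} (hgf : ∀ n, ∀ x ∈ D n, g n (f n x) = x)
    (hA : closure (unionGraphs D f) ⊆ unionGraphs D f ∪ diagonal X)
    (hirr : ∀ x, (x, x) ∉ unionGraphs D f) {ψ : Cantor → X} {B : Set X} (hB : IsClopen B)
    (hD : ∀ n d, IsClopen (stepDom D f n d))
    (hF : ∀ n d O, IsOpen O → IsOpen (stepDom D f n d ∩ stepFun f g n d ⁻¹' O))
    (hI : ∀ n d E, E ⊆ B → MeasurableSet E → IsMeagre (ψ ⁻¹' E) →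
      IsMeagre (ψ ⁻¹' (stepDom D f n d ∩ stepFun f g n d ⁻¹' E)))
    (hne : ¬ IsMeagre (ψ ⁻¹' B))
    (hedge : ∀ E, MeasurableSet E → ¬ IsMeagre (ψ ⁻¹' E) →
      ∃ x ∈ E, ∃ y ∈ E, (x, y) ∈ unionGraphs D f) :
    ∃ C ⊆ B, MeasurableSet C ∧ ConvSit C instTopologicalSpaceSubtype
      (fun n => subD C (D n) (f n)) (fun n => subF C (f n)) := by
  obtain ⟨b, hbc, -, hbb⟩ := exists_countable_basis X
  set N := ⋃₀ {O ∈ b | IsMeagre (ψ ⁻¹' (O ∩ B))} with hN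
  have hNo : IsOpen N := isOpen_sUnion fun O hO => hbb.isOpen hO.1
  have hNI : IsMeagre (ψ ⁻¹' (N ∩ B)) := by
    have : Countable {O ∈ b | IsMeagre (ψ ⁻¹' (O ∩ B))} :=
      (hbc.mono (sep_subset _ _)).to_subtype
    refine (isMeagre_iUnion (f := fun O : {O ∈ b | IsMeagre (ψ ⁻¹' (O ∩ B))} =>
      ψ ⁻¹' (O ∩ B)) fun O => O.2.2).mono ?_
    rintro x ⟨⟨O, hO, hxO⟩, hxB⟩
    exact mem_iUnion.2 ⟨⟨O, hO⟩, hxO, hxB⟩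
  have hNmax : ∀ O, IsOpen O → IsMeagre (ψ ⁻¹' (O ∩ B)) → O ⊆ N := fun O hO hOI x hx => by
    obtain ⟨V, hV, hxV, hVO⟩ := hbb.exists_subset_of_mem_open hx hO
    exact ⟨V, ⟨hV, hOI.mono (preimage_mono (inter_subset_inter_left B hVO))⟩, hxV⟩
  have hCcl : IsClosed (B \ N) := hB.isClosed.sdiff hNo
  have hlarge : ∀ O, IsOpen O → (O ∩ (B \ N)).Nonempty → ¬ IsMeagre (ψ ⁻¹' (O ∩ (B \ N))) := by
    rintro O hO ⟨x, hxO, -, hxN⟩ hI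
    refine hxN (hNmax O hO ((hI.union hNI).mono fun y hy => ?_) hxO)
    by_cases h : ψ y ∈ N
    · exact Or.inr ⟨h, hy.2⟩
    · exact Or.inl ⟨hy.1, hy.2, h⟩
  have hinv : ∀ n d, ∀ x ∈ B \ N, x ∈ stepDom D f n d → stepFun f g n d x ∈ B →
      stepFun f g n d x ∈ B \ N := by
    refine fun n d x hx hxD hxB => ⟨hxB, fun hxN => ?_⟩
    refine hlarge _ (hF n d _ (hNo.inter hB.isOpen)) ⟨x, ⟨hxD, hxN, hxB⟩, hx⟩ ?_
    exact (hI n d (N ∩ B) inter_subset_right (hNo.inter hB.isOpen).measurableSet hNI).mono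
      (preimage_mono inter_subset_left)
  have hclopen : ∀ n d, IsClopen (subD (B \ N) (stepDom D f n d) (stepFun f g n d)) := by
    intro n d
    have h₁ : IsClopen (stepDom D f n d ∩ stepFun f g n d ⁻¹' B) := by
      refine ⟨?_, hF n d _ hB.isOpen⟩
      have : stepDom D f n d ∩ stepFun f g n d ⁻¹' B =
          stepDom D f n d \ (stepDom D f n d ∩ stepFun f g n d ⁻¹' Bᶜ) := by
        ext x
        simp only [mem_inter_iff, mem_preimage, Set.mem_sdiff, mem_compl_iff]
        tauto
      rw [this]
      exact (hD n d).isClosed.sdiff (hF n d _ hB.compl.isOpen)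
    convert! h₁.preimage (continuous_subtype_val (p := (· ∈ B \ N))) using 1
    ext x
    exact ⟨fun hx => ⟨hx.1, hx.2.1⟩, fun hx => ⟨hx.1, hinv n d x x.2 hx.1 hx.2⟩⟩
  have hcont : ∀ n d, ContinuousOn (stepFun f g n d) (stepDom D f n d) := fun n d =>
    (continuousOn_open_iff (hD n d).isOpen).2 (hF n d)
  refine ⟨B \ N, sdiff_subset, hCcl.measurableSet, convSit_subtype hb hA hirr hCcl ?_
    (fun n => isPartialHomeo_subF (hcont n true) (hcont n false) (hgf n) (hclopen n true)
      (hclopen n false)) fun O hO hOne => hedge _ (hO.measurableSet.inter hCcl.measurableSet)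
      (hlarge O hO hOne)⟩
  rw [nonempty_iff_ne_empty]
  intro hemp
  refine hne (hNI.mono fun x hx => ?_)
  refine mem_preimage.2 ⟨by_contra fun h => ?_, hx⟩
  exact hemp.subset (show ψ x ∈ B \ N from ⟨hx, h⟩)

/-- If the sets which are large with respect to `ψ` contain edges of `A^f`, then there is a
converging situation obtained by restriction to a Borel subset of the range of `ψ`. -/
theorem ConvSit.exists_convSit_subset {X : Type} [t : TopologicalSpace X] {D : ℕ → Set X}
    {f : ℕ → X → X} (h : ConvSit X t D f) {ψ : Cantor → X} (hψ : Continuous ψ)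
    (hedge : ∀ E, MeasurableSet[borel X] E → ¬ IsMeagre (ψ ⁻¹' E) →
      ∃ x ∈ E, ∃ y ∈ E, (x, y) ∈ unionGraphs D f)
    {ι : Type} [Countable ι] {S : ι → Set X} (hS : ∀ i, MeasurableSet[borel X] (S i)) :
    ∃ C ⊆ range ψ, MeasurableSet[borel X] C ∧ ∃ T ≤ t, (∀ i, @IsClopen X T (S i)) ∧
      ConvSit C (subTop T C) (fun n => subD C (D n) (f n)) (fun n => subF C (f n)) := by
  have hP : PolishSpace X := h.2.1
  have hf := h.2.2.2.2.1
  choose hD hR hfc g hg hgf using hf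
  let m : MeasurableSpace X := borel X
  have : BorelSpace X := ⟨rfl⟩
  have hDD : ∀ n d, IsClopen (stepDom D f n d) := by
    rintro n (_ | _)
    · exact hR n
    · exact hD n
  have hFF : ∀ n d, ContinuousOn (stepFun f g n d) (stepDom D f n d) := by
    rintro n (_ | _)
    · exact hg n
    · exact hfc n
  have hFm : ∀ n d E, MeasurableSet E →
      MeasurableSet (stepDom D f n d ∩ stepFun f g n d ⁻¹' E) := fun n d E hE =>
    (hFF n d).measurableSet_inter_preimage_of_measurableSet (hDD n d).isOpen.measurableSet hE
  choose E₀ hE₀m hE₀I hE₀ using fun n d =>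
    exists_isMeagre_preimage_diff hψ.measurable (hFm n d)
  set B := range ψ \ ⋃ n, ⋃ d, E₀ n d with hB
  have hBm : MeasurableSet B := (isCompact_range hψ).isClosed.measurableSet.diff
    (.iUnion fun n => .iUnion (hE₀m n))
  have hBI : ∀ n d E, E ⊆ B → MeasurableSet E → IsMeagre (ψ ⁻¹' E) →
      IsMeagre (ψ ⁻¹' (stepDom D f n d ∩ stepFun f g n d ⁻¹' E)) := by
    intro n d E hEB hE hEI
    have := hE₀ n d E hE hEI
    rwa [sdiff_eq_left.2] at this
    exact disjoint_left.2 fun x hx hx' => (hEB hx).2 (mem_iUnion₂.2 ⟨n, d, hx'⟩)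
  have hBne : ¬ IsMeagre (ψ ⁻¹' B) := by
    intro hI
    refine not_isMeagre_of_isOpen (isOpen_univ (X := Cantor)) univ_nonempty ?_
    refine (hI.union (isMeagre_iUnion fun n => isMeagre_iUnion (hE₀I n))).mono fun x _ => ?_
    by_cases hx : ψ x ∈ ⋃ n, ⋃ d, E₀ n d
    · exact Or.inr (by simpa using hx)
    · exact Or.inl ⟨mem_range_self x, hx⟩
  have hcl := h.closure_subset
  have hirr := h.irrefl
  obtain ⟨T, hTt, hTP, hTb, hTS, hTF⟩ := exists_zeroDim_polishSpace
    (S := fun i : (Unit ⊕ (ℕ × Bool)) ⊕ ι =>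
      Sum.elim (Sum.elim (fun _ => B) fun k => stepDom D f k.1 k.2) S i)
    (by rintro ((_ | k) | i) <;> [exact hBm; exact (hDD _ _).isOpen.measurableSet; exact hS i])
    (fun k : ℕ × Bool => stepDom D f k.1 k.2) (fun k => stepFun f g k.1 k.2)
    fun k => hFm k.1 k.2
  have hbor : @borel X T = @borel X t := MeasureTheory.borel_eq_borel_of_le hTP hP hTt
  have hA : @closure (X × X) (@instTopologicalSpaceProd X X T T) (unionGraphs D f) ⊆
      unionGraphs D f ∪ diagonal X := by
    exact (closure.mono (TopologicalSpace.prod_mono hTt hTt)).trans hcl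
  obtain ⟨C, hCB, hCm, hC⟩ := @exists_convSit_subset_of_isMeagre X T hTP m
    (@BorelSpace.mk X T m hbor.symm) hTb D f g hgf hA hirr ψ B (hTS (Sum.inl (Sum.inl ())))
    (fun n d => hTS (Sum.inl (Sum.inr (n, d)))) (fun n d => hTF (n, d)) hBI hBne hedge
  exact ⟨C, hCB.trans sdiff_subset, hCm, T, hTt, fun i => hTS (Sum.inr i), hC⟩

theorem ConvSit.measurableSet_unionGraphs {X : Type} [t : TopologicalSpace X] {D : ℕ → Set X}
    {f : ℕ → X → X} (h : ConvSit X t D f) : MeasurableSet[borel (X × X)] (unionGraphs D f) := by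
  have : PolishSpace X := h.2.1
  let _ : MeasurableSpace (X × X) := borel (X × X)
  have : BorelSpace (X × X) := ⟨rfl⟩
  have hA : unionGraphs D f = closure (unionGraphs D f) \ diagonal X := by
    refine Subset.antisymm (fun p hp => ⟨subset_closure hp, ?_⟩)
      fun p hp => (h.closure_subset hp.1).resolve_right hp.2
    rintro hpd
    rw [h.2.2.2.2.2] at hpd
    exact hpd.2 hp
  rw [hA]
  exact isClosed_closure.measurableSet.diff isClosed_diagonal.measurableSet

theorem potClosed_of_isCountablyIndep {X X' Y' : Type} [t : TopologicalSpace X] [PolishSpace X]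
    [MeasurableSpace X] [BorelSpace X]
    {A : Set (X × X)} (hA : closure A ⊆ A ∪ diagonal X) [tX' : TopologicalSpace X']
    [PolishSpace X'] [tY' : TopologicalSpace Y'] [PolishSpace Y'] {u : X' → X} {v : Y' → X}
    (hu : Continuous u) (hv : Continuous v)
    (h : IsCountablyIndep A (range fun p : {p : X' × Y' // u p.1 = v p.2} => u p.1.1)) :
    PotClosed tX' tY' ((fun p => (u p.1, v p.2)) ⁻¹' A) := by
  let mX' : MeasurableSpace X' := borel X'
  have : BorelSpace X' := ⟨rfl⟩
  let mY' : MeasurableSpace Y' := borel Y'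
  have : BorelSpace Y' := ⟨rfl⟩
  obtain ⟨B, hB, hrB⟩ := h
  have ho : IsOpen ((fun p : X' × Y' => (u p.1, v p.2)) ⁻¹' (closure A)ᶜ) :=
    isClosed_closure.isOpen_compl.preimage (by fun_prop)
  obtain ⟨σ, hσ, hσP, hσB⟩ := exists_polishSpace_forall_isClopen
    (S := fun k => u ⁻¹' B k) fun k => hu.measurable (hB k).1
  obtain ⟨τ, hτ, hτP, hτB⟩ := exists_polishSpace_forall_isClopen
    (S := fun k => v ⁻¹' B k) fun k => hv.measurable (hB k).1
  refine ⟨σ, τ, hσ, hτ, hσP, hτP, ?_⟩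
  have hc : (((fun p : X' × Y' => (u p.1, v p.2)) ⁻¹' A)ᶜ) =
      ((fun p => (u p.1, v p.2)) ⁻¹' (closure A)ᶜ) ∪ ⋃ k, (u ⁻¹' B k) ×ˢ (v ⁻¹' B k) := by
    ext ⟨x, y⟩
    constructor
    · intro hxy
      by_cases hcl : (u x, v y) ∈ closure A
      · have huv : u x = v y := (hA hcl).resolve_left hxy
        obtain ⟨k, hk⟩ := mem_iUnion.1 (hrB ⟨⟨(x, y), huv⟩, rfl⟩)
        exact Or.inr (mem_iUnion.2 ⟨k, hk, show v y ∈ B k from huv ▸ hk⟩)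
      · exact Or.inl hcl
    · rintro (hxy | hxy) hxyA
      · exact hxy (subset_closure hxyA)
      · obtain ⟨k, hx, hy⟩ := mem_iUnion.1 hxy
        exact (hB k).2 _ hx _ hy hxyA
  have hle := TopologicalSpace.prod_mono hσ hτ
  let _ := σ
  let _ := τ
  rw [← isOpen_compl_iff, hc]
  exact (hle _ ho).union (isOpen_iUnion fun k => (hσB k).isOpen.prod (hτB k).isOpen)

theorem RedRC.trans {X Y X' Y' X'' Y'' : Type} {tX : TopologicalSpace X} {tY : TopologicalSpace Y}
    {tX' : TopologicalSpace X'} {tY' : TopologicalSpace Y'} {tX'' : TopologicalSpace X''}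
    {tY'' : TopologicalSpace Y''} {A : Set (X × Y)} {A' : Set (X' × Y')} {A'' : Set (X'' × Y'')}
    (h : RedRC tX tY tX' tY' A A') (h' : RedRC tX' tY' tX'' tY'' A' A'') :
    RedRC tX tY tX'' tY'' A A'' := by
  obtain ⟨u, v, hu, hv, rfl⟩ := h
  obtain ⟨u', v', hu', hv', rfl⟩ := h'
  exact ⟨u' ∘ u, v' ∘ v, hu'.comp hu, hv'.comp hv, rfl⟩

theorem redRC_restrGraphs {X : Type} {t : TopologicalSpace X} {D : ℕ → Set X} {f : ℕ → X → X}
    {B : Set X} {τ : TopologicalSpace B} (hτ : τ ≤ subTop t B) :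
    RedRC τ τ t t (restrGraphs B D f) (unionGraphs D f) := by
  have hc : @Continuous B X τ t Subtype.val := continuous_iff_le_induced.2 hτ
  exact ⟨Subtype.val, Subtype.val, hc, hc, Set.ext fun _ => mem_restrGraphs⟩

theorem measurableSet_of_redRC {X Y X' Y' : Type} [tX : TopologicalSpace X]
    [tY : TopologicalSpace Y] [tX' : TopologicalSpace X'] [tY' : TopologicalSpace Y']
    {A : Set (X × Y)} {A' : Set (X' × Y')} (h : RedRC tX tY tX' tY' A A')
    (hA' : MeasurableSet[borel (X' × Y')] A') : MeasurableSet[borel (X × Y)] A := by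
  obtain ⟨u, v, hu, hv, rfl⟩ := h
  have : Continuous fun p : X × Y => (u p.1, v p.2) := by fun_prop
  exact this.borel_measurable hA'

/-- If a relation reducible to `A^f` is not potentially closed, then some converging situation
obtained by restricting `A^f` is reducible to it. -/
theorem ConvSit.exists_redRC {X : Type} [t : TopologicalSpace X] {D : ℕ → Set X}
    {f : ℕ → X → X} (h : ConvSit X t D f) {X' Y' : Type} [tX' : TopologicalSpace X']
    [PolishSpace X'] [tY' : TopologicalSpace Y'] [PolishSpace Y'] {A' : Set (X' × Y')}
    (hA' : ¬ PotClosed tX' tY' A') (hred : RedRC tX' tY' t t A' (unionGraphs D f)) :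
    ∃ C, MeasurableSet[borel X] C ∧ ∃ τ ≤ subTop t C,
      ConvSit C τ (fun n => subD C (D n) (f n)) (fun n => subF C (f n)) ∧
      RedRC τ τ tX' tY' (restrGraphs C D f) A' := by
  have hP : PolishSpace X := h.2.1
  let m : MeasurableSpace X := borel X
  have : BorelSpace X := ⟨rfl⟩
  obtain ⟨u, v, hu, hv, rfl⟩ := hred
  have : PolishSpace {p : X' × Y' // u p.1 = v p.2} :=
    (isClosed_eq (hu.comp continuous_fst) (hv.comp continuous_snd)).polishSpace
  have hw : Continuous fun p : {p : X' × Y' // u p.1 = v p.2} => u p.1.1 := by fun_prop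
  have hAm : MeasurableSet (unionGraphs D f) := by
    have := h.measurableSet_unionGraphs
    rwa [← BorelSpace.measurable_eq (α := X × X)] at this
  obtain ⟨s, hs⟩ := exists_dense_cantorRes
  obtain ⟨φ, hφ, hφA⟩ := exists_hom_of_not_isCountablyIndep h.closure_subset hAm h.irrefl
    (fun S hS hSi => hSi.exists_measurableSet (fun n => (h.2.2.2.2.1 n).1.isOpen.measurableSet)
      (fun n => (h.2.2.2.2.1 n).2.2.1) hS)
    hw s fun hI => hA' (potClosed_of_isCountablyIndep h.closure_subset hu hv hI)
  set ψ : Cantor → X := fun x => u (φ x).1.1 with hψ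
  have hψc : Continuous ψ := hw.comp hφ
  obtain ⟨σ, hσm, hσ⟩ := exists_measurable_section hψc
  obtain ⟨C, hCψ, hCm, T, hT, hTσ, hC⟩ := h.exists_convSit_subset hψc
    (fun E hE hE' => exists_mem_of_not_isMeagre hs hφA (hψc.measurable hE) hE') hσm
  refine ⟨C, hCm, subTop T C, induced_mono hT, hC, ?_⟩
  have hσc : @Continuous C Cantor (subTop T C) _ fun c => σ c := by
    let _ := T
    refine Continuous.comp (g := σ) ?_ continuous_subtype_val
    exact continuous_pi fun n => (continuous_bool_rng true).2 (hTσ n)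
  have h₁ : Continuous fun x => (φ x).1.1 := by fun_prop
  have h₂ : Continuous fun x => (φ x).1.2 := by fun_prop
  refine ⟨fun c => (φ (σ c)).1.1, fun c => (φ (σ c)).1.2, h₁.comp hσc, h₂.comp hσc, ?_⟩
  ext ⟨x, y⟩
  have hx : u (φ (σ x)).1.1 = x := hσ x (hCψ x.2)
  have hy : v (φ (σ y)).1.2 = y := (φ (σ y)).2.symm.trans (hσ y (hCψ y.2))
  rw [mem_restrGraphs, mem_preimage, mem_preimage, hx, hy]

end

theorem stmt8 {X : Type} (t : TopologicalSpace X) (D : ℕ → Set X) (f : ℕ → X → X)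
    (hconv : ConvSit X t D f) :
    (MinNonPotClosed t t (unionGraphs D f) ↔
      ∀ B : Set X, @MeasurableSet X (@borel X t) B →
        ∀ τ : TopologicalSpace ↥B, τ ≤ subTop t B → @PolishSpace ↥B τ →
          ¬ PotClosed τ τ (restrGraphs B D f) →
          RedRC t t τ τ (unionGraphs D f) (restrGraphs B D f)) ∧
    ((∀ B : Set X, @MeasurableSet X (@borel X t) B →
        ∀ τ : TopologicalSpace ↥B, τ ≤ subTop t B → @PolishSpace ↥B τ →
          ¬ PotClosed τ τ (restrGraphs B D f) →
          RedRC t t τ τ (unionGraphs D f) (restrGraphs B D f)) ↔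
      ∀ B : Set X, @MeasurableSet X (@borel X t) B →
        ∀ τ : TopologicalSpace ↥B, τ ≤ subTop t B →
          ConvSit ↥B τ (fun n => subD B (D n) (f n)) (fun n => subF B (f n)) →
          RedRC t t τ τ (unionGraphs D f) (restrGraphs B D f)) := by
  have hab : ∀ B : Set X, ∀ τ : TopologicalSpace ↥B, τ ≤ subTop t B → @PolishSpace ↥B τ →
      ¬ PotClosed τ τ (restrGraphs B D f) → MinNonPotClosed t t (unionGraphs D f) →
      RedRC t t τ τ (unionGraphs D f) (restrGraphs B D f) := fun B τ hτ hP hB hmin =>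
    hmin.2 _ _ τ τ hP hP _ (measurableSet_of_redRC (redRC_restrGraphs hτ)
      hconv.measurableSet_unionGraphs) hB (redRC_restrGraphs hτ)
  have hca : (∀ B : Set X, @MeasurableSet X (@borel X t) B →
      ∀ τ : TopologicalSpace ↥B, τ ≤ subTop t B →
        ConvSit ↥B τ (fun n => subD B (D n) (f n)) (fun n => subF B (f n)) →
        RedRC t t τ τ (unionGraphs D f) (restrGraphs B D f)) →
      MinNonPotClosed t t (unionGraphs D f) := by
    refine fun hc => ⟨hconv.not_potClosed, fun X' Y' tX' tY' hX' hY' A' _ hA' hred => ?_⟩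
    obtain ⟨C, hCm, τ, hτ, hC, hCA'⟩ := hconv.exists_redRC hA' hred
    exact (hc C hCm τ hτ hC).trans hCA'
  exact ⟨⟨fun ha B _ τ hτ hP hB => hab B τ hτ hP hB ha,
      fun hb => hca fun B hBm τ hτ hB => hb B hBm τ hτ hB.2.1 hB.not_potClosed⟩,
    fun hb B hBm τ hτ hB => hb B hBm τ hτ hB.2.1 hB.not_potClosed,
    fun hc B _ τ hτ hP hB => hab B τ hτ hP hB (hca hc)⟩
end

section
/- Let Θ = (θ_n)_{n∈ω} be a sequence of finite binary sequences with |θ_n| = n for every n. Then: (a) for each n ∈ ω, the set 2^n is s(ℜ_Θ)-connected; (b) the relation s(ℜ_Θ) is acyclic; (c) if e, e' ∈ 2^n and l < n is maximal with e(l) ≠ e'(l), then along the unique injective s(ℜ_Θ)-path from e to e', the coordinate l is changed exactly once, and all other changed coordinates are at levels below l. -/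
open Set Topology

section RTheta

variable {θ : ℕ → List Bool}

lemma sRTheta.exists_flip {x y : List Bool} (h : sRTheta θ x y) (hne : x ≠ y) :
    ∃ (n : ℕ) (b : Bool) (w : List Bool), x = θ n ++ b :: w ∧ y = θ n ++ (!b) :: w := by
  rcases h with (h | ⟨n, w, hx, hy⟩) | (h | ⟨n, w, hy, hx⟩)
  · exact absurd h hne
  · exact ⟨n, false, w, hx, hy⟩
  · exact absurd h.symm hne
  · exact ⟨n, true, w, hx, hy⟩

lemma sRTheta.length_eq {x y : List Bool} (h : sRTheta θ x y) : x.length = y.length := by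
  by_cases hne : x = y
  · rw [hne]
  · obtain ⟨n, b, w, rfl, rfl⟩ := h.exists_flip hne
    simp

lemma sRTheta.append {x y : List Bool} (h : sRTheta θ x y) (v : List Bool) :
    sRTheta θ (x ++ v) (y ++ v) := by
  rcases h with (h | ⟨n, w, hx, hy⟩) | (h | ⟨n, w, hy, hx⟩)
  · exact .inl (.inl (by rw [h]))
  · exact .inl (.inr ⟨n, w ++ v, by simp [hx], by simp [hy]⟩)
  · exact .inr (.inl (by rw [h]))
  · exact .inr (.inr ⟨n, w ++ v, by simp [hy], by simp [hx]⟩)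

/-- A step of `s(ℜ_Θ)` changing the coordinate `k` does so right after the prefix `θ k`. -/
lemma sRTheta.getD_of_lt (hθ : ∀ n, (θ n).length = n) {x y : List Bool} (h : sRTheta θ x y)
    {k : ℕ} (hk : x.getD k false ≠ y.getD k false) {j : ℕ} (hj : j < k) :
    x.getD j false = (θ k).getD j false ∧ y.getD j false = (θ k).getD j false := by
  obtain ⟨n, b, w, rfl, rfl⟩ := h.exists_flip (fun h' => hk (by rw [h']))
  have hkn : k = n := by
    by_contra hne
    apply hk
    rcases lt_or_gt_of_ne hne with hlt | hgt
    · rw [List.getD_append _ _ _ _ (by rwa [hθ]), List.getD_append _ _ _ _ (by rwa [hθ])]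
    · rw [List.getD_append_right _ _ _ _ (by rw [hθ]; omega),
        List.getD_append_right _ _ _ _ (by rw [hθ]; omega), hθ]
      obtain ⟨d, hd⟩ : ∃ d, k - n = d + 1 := ⟨k - n - 1, by omega⟩
      simp [hd]
  subst hkn
  constructor <;> rw [List.getD_append _ _ _ _ (by rwa [hθ])]

lemma list_ext_getD {α : Type*} {d : α} {x y : List α} (hl : x.length = y.length)
    (h : ∀ j, x.getD j d = y.getD j d) : x = y := by
  refine List.ext_getElem hl fun i h₁ h₂ => ?_
  have := h i
  rwa [List.getD_eq_getElem _ _ h₁, List.getD_eq_getElem _ _ h₂] at this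

lemma eq_of_forall_eq_succ {α : Type*} {f : ℕ → α} {a b : ℕ} (hab : a ≤ b)
    (h : ∀ k, a ≤ k → k < b → f k = f (k + 1)) : f a = f b := by
  induction b, hab using Nat.le_induction with
  | base => rfl
  | succ b hab ih =>
    rw [ih fun k h₁ h₂ => h k h₁ (by omega), h b hab (by omega)]

lemma length_eq_of_path {p : ℕ → List Bool} {m : ℕ}
    (hp : ∀ i, i < m → sRTheta θ (p i) (p (i + 1))) {i : ℕ} (hi : i ≤ m) :
    (p i).length = (p 0).length :=
  (eq_of_forall_eq_succ (f := fun k => (p k).length) (Nat.zero_le i)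
    fun k _ hk => (hp k (by omega)).length_eq).symm

/-- A nonconstant `s(ℜ_Θ)`-path which never uses the same edge twice changes its highest
changed coordinate exactly once. -/
lemma exists_top_level_unique_flip (hθ : ∀ n, (θ n).length = n) {p : ℕ → List Bool} {m : ℕ}
    (hp : ∀ i, i < m → sRTheta θ (p i) (p (i + 1)))
    (hedge : ∀ i j, i < j → j < m →
      ¬ (p i = p j ∧ p (i + 1) = p (j + 1)) ∧ ¬ (p i = p (j + 1) ∧ p (i + 1) = p j))
    (hne : ∃ i, i < m ∧ p i ≠ p (i + 1)) :
    ∃ l, (∀ i, i < m → ∀ j, l < j → (p i).getD j false = (p (i + 1)).getD j false) ∧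
      (∃! i, i < m ∧ (p i).getD l false ≠ (p (i + 1)).getD l false) ∧
      (p 0).getD l false ≠ (p m).getD l false := by
  classical
  let P : ℕ → Prop := fun l => ∃ i, i < m ∧ (p i).getD l false ≠ (p (i + 1)).getD l false
  have hbound : ∀ l, P l → l ≤ (p 0).length := by
    rintro l ⟨i, hi, hl⟩
    by_contra! hlt
    apply hl
    rw [List.getD_eq_default _ _ (by rw [length_eq_of_path hp (by omega)]; omega),
      List.getD_eq_default _ _ (by rw [length_eq_of_path hp (by omega)]; omega)]
  obtain ⟨l₀, hl₀⟩ : ∃ l, P l := by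
    obtain ⟨i, hi, hne⟩ := hne
    by_contra! hno
    exact hne (list_ext_getD (d := false) (hp i hi).length_eq fun j => by
      by_contra hj
      exact hno j ⟨i, hi, hj⟩)
  set l := Nat.findGreatest P (p 0).length
  obtain ⟨i, hi, hil⟩ : P l := Nat.findGreatest_spec (hbound l₀ hl₀) hl₀
  have htop : ∀ i, i < m → ∀ j, l < j → (p i).getD j false = (p (i + 1)).getD j false := by
    intro i hi j hj
    by_contra hne
    have hPj : P j := ⟨i, hi, hne⟩
    exact Nat.findGreatest_is_greatest hj (hbound j hPj) hPj
  have hconst : ∀ i, i ≤ m → ∀ j, l < j → (p 0).getD j false = (p i).getD j false :=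
    fun i hi j hj => eq_of_forall_eq_succ (f := fun k => (p k).getD j false) (Nat.zero_le i)
      fun k _ hk => htop k (by omega) j hj
  have hno : ∀ i j, i < j → j < m → (p i).getD l false ≠ (p (i + 1)).getD l false →
      (p j).getD l false ≠ (p (j + 1)).getD l false → False := by
    intro i j hij hj h₁ h₂
    have key : ∀ a b, a ≤ m → b ≤ m →
        (∀ k, k < l → (p a).getD k false = (θ l).getD k false) →
        (∀ k, k < l → (p b).getD k false = (θ l).getD k false) →
        (p a).getD l false = (p b).getD l false → p a = p b := by
      intro a b ha hb hka hkb hab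
      refine list_ext_getD (d := false)
        ((length_eq_of_path hp ha).trans (length_eq_of_path hp hb).symm) fun k => ?_
      rcases lt_trichotomy k l with hk | rfl | hk
      · rw [hka k hk, hkb k hk]
      · exact hab
      · rw [← hconst a ha k hk, ← hconst b hb k hk]
    have hi := fun k hk => (hp i (by omega)).getD_of_lt hθ h₁ (j := k) hk
    have hj' := fun k hk => (hp j hj).getD_of_lt hθ h₂ (j := k) hk
    by_cases heq : (p i).getD l false = (p j).getD l false
    · refine (hedge i j hij hj).1 ⟨key _ _ (by omega) (by omega) (fun k hk => (hi k hk).1)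
        (fun k hk => (hj' k hk).1) heq, key _ _ (by omega) (by omega)
        (fun k hk => (hi k hk).2) (fun k hk => (hj' k hk).2) ?_⟩
      rw [Bool.eq_not.2 h₁.symm, Bool.eq_not.2 h₂.symm, heq]
    · refine (hedge i j hij hj).2 ⟨key _ _ (by omega) (by omega) (fun k hk => (hi k hk).1)
        (fun k hk => (hj' k hk).2) ?_, key _ _ (by omega) (by omega)
        (fun k hk => (hi k hk).2) (fun k hk => (hj' k hk).1) ?_⟩
      · rw [Bool.eq_not.2 heq, Bool.eq_not.2 h₂.symm]
      · rw [Bool.eq_not.2 h₁.symm, Bool.eq_not.2 heq, Bool.not_not]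
  have huniq : ∀ j, j < m → (p j).getD l false ≠ (p (j + 1)).getD l false → j = i := by
    intro j hj hjl
    rcases lt_trichotomy j i with h | h | h
    · exact (hno j i h hi hjl hil).elim
    · exact h
    · exact (hno i j h hj hil hjl).elim
  refine ⟨l, htop, ⟨i, ⟨hi, hil⟩, fun j hj => huniq j hj.1 hj.2⟩, ?_⟩
  have hbefore : (p 0).getD l false = (p i).getD l false :=
    eq_of_forall_eq_succ (f := fun k => (p k).getD l false) (Nat.zero_le i) fun k _ hk => by
      by_contra h
      exact hk.ne (huniq k (by omega) h)
  have hafter : (p (i + 1)).getD l false = (p m).getD l false :=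
    eq_of_forall_eq_succ (f := fun k => (p k).getD l false) (show i + 1 ≤ m by omega)
      fun k hk hkm => by
        by_contra h
        have := huniq k hkm h
        omega
  rwa [hbefore, ← hafter]

lemma reflTransGen_sRTheta (hθ : ∀ n, (θ n).length = n) (n : ℕ) :
    ∀ e e' : List Bool, e.length = n → e'.length = n →
      Relation.ReflTransGen (sRTheta θ) e e' := by
  induction n with
  | zero =>
    intro e e' he he'
    rw [List.length_eq_zero_iff.1 he, List.length_eq_zero_iff.1 he']
  | succ n ih =>
    intro e e' he he'
    obtain ⟨x, b, rfl⟩ := (List.eq_nil_or_concat' e).resolve_left (by rintro rfl; simp at he)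
    obtain ⟨x', b', rfl⟩ := (List.eq_nil_or_concat' e').resolve_left (by rintro rfl; simp at he')
    have hlift : ∀ (c : Bool) (y y' : List Bool), y.length = n → y'.length = n →
        Relation.ReflTransGen (sRTheta θ) (y ++ [c]) (y' ++ [c]) := fun c y y' hy hy' =>
      (ih y y' hy hy').lift (fun z => z ++ [c]) fun _ _ h => sRTheta.append h [c]
    have hx : x.length = n := by simpa using he
    have hx' : x'.length = n := by simpa using he'
    have hstep : sRTheta θ (θ n ++ [b]) (θ n ++ [b']) := by
      cases b <;> cases b'
      · exact .inl (.inl rfl)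
      · exact .inl (.inr ⟨n, [], rfl, rfl⟩)
      · exact .inr (.inr ⟨n, [], rfl, rfl⟩)
      · exact .inl (.inl rfl)
    exact ((hlift b x (θ n) hx (hθ n)).tail hstep).trans (hlift b' (θ n) x' (hθ n) hx')

lemma exists_path_of_reflTransGen {α : Type*} {r : α → α → Prop} {a b : α}
    (h : Relation.ReflTransGen r a b) :
    ∃ (p : ℕ → α) (m : ℕ), p 0 = a ∧ p m = b ∧ ∀ i, i < m → r (p i) (p (i + 1)) := by
  induction h using Relation.ReflTransGen.head_induction_on with
  | refl => exact ⟨fun _ => b, 0, rfl, rfl, by simp⟩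
  | @head a c hac _ ih =>
    obtain ⟨p, m, h0, hm, hp⟩ := ih
    refine ⟨fun i => Nat.casesOn i a p, m + 1, rfl, hm, ?_⟩
    rintro (_ | i) hi
    · simpa [h0] using hac
    · exact hp i (by omega)

end RTheta

theorem stmt9 (θ : ℕ → List Bool) (hθ : ∀ n, (θ n).length = n) :
    (∀ (n : ℕ) (e e' : List Bool), e.length = n → e'.length = n →
      ∃ (p : ℕ → List Bool) (m : ℕ), p 0 = e ∧ p m = e' ∧
        (∀ i, i ≤ m → (p i).length = n) ∧ ∀ i, i < m → sRTheta θ (p i) (p (i + 1))) ∧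
    (¬ ∃ (p : ℕ → List Bool) (m : ℕ), 3 ≤ m ∧
      (∀ i, i < m → sRTheta θ (p i) (p (i + 1))) ∧
      ∀ i j, i ≤ m → j ≤ m → i ≠ j →
        (p i = p j ↔ (i = 0 ∧ j = m) ∨ (i = m ∧ j = 0))) ∧
    (∀ (n : ℕ) (e e' : List Bool) (l : ℕ), e.length = n → e'.length = n → l < n →
      e.getD l false ≠ e'.getD l false →
      (∀ j, l < j → e.getD j false = e'.getD j false) →
      ∀ (p : ℕ → List Bool) (m : ℕ), p 0 = e → p m = e' →
        (∀ i, i < m → sRTheta θ (p i) (p (i + 1))) →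
        Set.InjOn p (Set.Iic m) →
        (∀ i, i < m → ∀ j, l < j → (p i).getD j false = (p (i + 1)).getD j false) ∧
        ∃! i : ℕ, i < m ∧ (p i).getD l false ≠ (p (i + 1)).getD l false) := by
  refine ⟨?_, ?_, ?_⟩
  · intro n e e' he he'
    obtain ⟨p, m, h0, hm, hp⟩ := exists_path_of_reflTransGen (reflTransGen_sRTheta hθ n e e' he he')
    exact ⟨p, m, h0, hm, fun i hi => by rw [length_eq_of_path hp hi, h0, he], hp⟩
  · rintro ⟨p, m, hm, hp, hcyc⟩
    have hclosed : p 0 = p m :=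
      (hcyc 0 m (by omega) le_rfl (by omega)).2 (.inl ⟨rfl, rfl⟩)
    obtain ⟨l, -, -, hl⟩ := exists_top_level_unique_flip hθ hp
      (by
        refine fun i j hij hj => ⟨fun h => ?_, fun h => ?_⟩
        · have := (hcyc i j (by omega) (by omega) (by omega)).1 h.1
          omega
        · have h₁ := (hcyc i (j + 1) (by omega) (by omega) (by omega)).1 h.1
          by_cases hji : i + 1 = j
          · omega
          · have h₂ := (hcyc (i + 1) j (by omega) (by omega) hji).1 h.2
            omega)
      ⟨0, by omega, fun h => by
        have := (hcyc 0 1 (by omega) (by omega) (by omega)).1 h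
        omega⟩
    exact hl (by rw [hclosed])
  · intro n e e' l _ _ _ hl htop p m h0 hm hp hinj
    have hinj' : ∀ i j, i ≤ m → j ≤ m → p i = p j → i = j := fun i j hi hj h => hinj hi hj h
    have hm0 : 0 < m := by
      by_contra h
      obtain rfl : m = 0 := by omega
      exact hl (by rw [← h0, ← hm])
    obtain ⟨L, htopL, huniq, hL⟩ := exists_top_level_unique_flip hθ hp
      (by
        refine fun i j hij hj => ⟨fun h => ?_, fun h => ?_⟩
        · have := hinj' i j (by omega) (by omega) h.1
          omega
        · have := hinj' i (j + 1) (by omega) (by omega) h.1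
          omega)
      ⟨0, hm0, fun h => by
        have := hinj' 0 1 (by omega) (by omega) h
        omega⟩
    obtain rfl : L = l := by
      rcases lt_trichotomy L l with h | h | h
      · refine absurd ?_ hl
        rw [← h0, ← hm]
        exact eq_of_forall_eq_succ (f := fun k => (p k).getD l false) (Nat.zero_le m)
          fun k _ hk => htopL k hk l h
      · exact h
      · exact absurd (by rw [h0, hm]; exact htop L h) hL
    exact ⟨htopL, huniq⟩
end

section
/- Let S ⊆ ω be infinite with 0 ∈ S and satisfying condition (H). Let B be a Borel subset of 2^ω and τ a finer topology on B such that ([B,τ],(f^B_n)_n) is a converging situation. Then A^S ≤ʳ_c A^S ∩ B². -/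
open Set Topology

/-- Converging situations pull back along injections with clopen range. -/
theorem ConvSit.comap {X Y : Type} [tX : TopologicalSpace X] [Nonempty Y] {e : Y → X}
    (he : Function.Injective e) (hr : IsClopen (range e))
    {D : ℕ → Set X} {f : ℕ → X → X} {D' : ℕ → Set Y} {f' : ℕ → Y → Y}
    (hD : ∀ n y, y ∈ D' n ↔ e y ∈ D n ∧ f n (e y) ∈ range e)
    (hf : ∀ n, ∀ y ∈ D' n, e (f' n y) = f n (e y)) (h : ConvSit X tX D f) :
    ConvSit Y (tX.induced e) D' f' := by
  let : TopologicalSpace Y := tX.induced e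
  have hind : IsInducing e := ⟨rfl⟩
  have hopen : IsOpenEmbedding e := ⟨⟨hind, he⟩, hr.isOpen⟩
  obtain ⟨-, hpol, hbasis, hperf, hhomeo, hdiag⟩ := h
  refine ⟨‹_›, (IsClosedEmbedding.mk ⟨hind, he⟩ hr.isClosed).polishSpace, ?_, ?_, ?_, ?_⟩
  · refine TopologicalSpace.isTopologicalBasis_of_isOpen_of_nhds (fun u hu => hu.isOpen) ?_
    intro y u hy hu
    obtain ⟨v, hv, hyv, hvu⟩ :=
      hbasis.mem_nhds_iff.1 ((hopen.isOpenMap u hu).mem_nhds (mem_image_of_mem e hy))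
    refine ⟨e ⁻¹' v, IsClopen.preimage hv hind.continuous, hyv, ?_⟩
    intro z hz
    exact (he.mem_set_image).1 (hvu hz)
  · refine ⟨isClosed_univ, fun y _ => accPt_iff_nhds.2 fun u hu => ?_⟩
    obtain ⟨x, ⟨hxu, -⟩, hne⟩ :=
      accPt_iff_nhds.1 (hperf.acc (e y) (mem_univ _)) (e '' u) (hopen.isOpenMap.image_mem_nhds hu)
    obtain ⟨z, hz, rfl⟩ := hxu
    exact ⟨z, ⟨hz, mem_univ _⟩, fun hzy => hne (hzy ▸ rfl)⟩
  · intro n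
    obtain ⟨hd, hi, hc, g, hg, hgf⟩ := hhomeo n
    have hD' : D' n = e ⁻¹' (D n ∩ f n ⁻¹' range e) := ext fun y => hD n y
    have him : f' n '' D' n = e ⁻¹' (f n '' D n ∩ g ⁻¹' range e) := by
      ext y
      constructor
      · rintro ⟨z, hz, rfl⟩
        have hzD := (hD n z).1 hz
        rw [mem_preimage, hf n z hz]
        exact ⟨mem_image_of_mem _ hzD.1, by rw [mem_preimage, hgf _ hzD.1]; exact mem_range_self z⟩
      · rintro ⟨⟨x, hx, hxy⟩, hgy⟩
        rw [mem_preimage, ← hxy, hgf x hx] at hgy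
        obtain ⟨z, rfl⟩ := hgy
        have hz : z ∈ D' n := (hD n z).2 ⟨hx, hxy ▸ mem_range_self y⟩
        exact ⟨z, hz, he ((hf n z hz).trans hxy)⟩
    refine ⟨?_, ?_, ?_, fun y => Function.invFun e (g (e y)), ?_, ?_⟩
    · rw [hD']
      exact (hc.preimage_isClopen_of_isClopen hd hr).preimage hind.continuous
    · rw [him]
      exact (hg.preimage_isClopen_of_isClopen hi hr).preimage hind.continuous
    · rw [hind.continuousOn_iff]
      refine ContinuousOn.congr (f := f n ∘ e) ?_ (hf n)
      exact hc.comp hind.continuous.continuousOn fun y hy => ((hD n y).1 hy).1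
    · rw [hind.continuousOn_iff, him]
      refine ContinuousOn.congr (f := g ∘ e) ?_ fun y hy => Function.invFun_eq hy.2
      exact hg.comp hind.continuous.continuousOn fun y hy => hy.1
    · intro y hy
      change Function.invFun e (g (e (f' n y))) = y
      rw [hf n y hy, hgf _ ((hD n y).1 hy).1, Function.leftInverse_invFun he]
  · have hgraph : unionGraphs D' f' = Prod.map e e ⁻¹' unionGraphs D f := by
      ext ⟨x, y⟩
      simp only [unionGraphs, graphRel, mem_iUnion, mem_ofPred_eq, mem_preimage, Prod.map]
      refine exists_congr fun n => ⟨?_, ?_⟩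
      · rintro ⟨hx, rfl⟩
        exact ⟨((hD n x).1 hx).1, hf n x hx⟩
      · rintro ⟨hx, hxy⟩
        have hx' : x ∈ D' n := (hD n x).2 ⟨hx, hxy ▸ mem_range_self y⟩
        exact ⟨hx', he (hxy.trans (hf n x hx').symm)⟩
    have hee := hopen.prodMap hopen
    rw [hgraph, ← hee.isOpenMap.preimage_closure_eq_closure_preimage hee.continuous,
      ← preimage_sdiff, ← hdiag]
    ext ⟨x, y⟩
    exact he.eq_iff.symm

/-- Condition (H) inside a nonempty clopen subset of a converging situation. -/
theorem CondH.exists_mem_clopen {S : Set ℕ} (hH : CondH S) {X : Type} [tX : TopologicalSpace X]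
    {j : X → Cantor} (hj : Continuous j) (hinj : Function.Injective j)
    {D : ℕ → Set X} {f : ℕ → X → X}
    (hD : ∀ n x, x ∈ D n ↔ j x ∈ DSdom S n ∧ fSfun n (j x) ∈ range j)
    (hf : ∀ n, ∀ x ∈ D n, j (f n x) = fSfun n (j x)) (h : ConvSit X tX D f)
    {U : Set X} (hU : IsClopen U) (hne : U.Nonempty) (l p : ℕ) :
    ∃ n, l ≤ n ∧ ∃ x ∈ U, x ∈ D n ∧ f n x ∈ U ∧
      ∀ m ≤ p, cardOnes (j x) n + m ∈ S ↔ m ∈ S := by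
  have hpol := h.2.1
  have hC : @MeasurableSet Cantor (borel Cantor) (j '' U) := by
    borelize X
    let : MeasurableSpace Cantor := borel Cantor
    have : BorelSpace Cantor := ⟨rfl⟩
    exact hU.isOpen.measurableSet.image_of_continuousOn_injOn hj.continuousOn hinj.injOn
  choose e heU hej using fun c : ↥(j '' U) => c.2
  have he : Function.Injective e := fun c d hcd => Subtype.ext (by rw [← hej c, ← hej d, hcd])
  have hrange : range e = U := by
    ext x
    refine ⟨?_, fun hx => ⟨⟨j x, mem_image_of_mem j hx⟩, hinj (hej _)⟩⟩
    rintro ⟨c, rfl⟩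
    exact heU c
  have : Nonempty ↥(j '' U) := (hne.image j).to_subtype
  have hfe : ∀ n (c : ↥(j '' U)), e c ∈ D n → j (f n (e c)) = fSfun n c := fun n c hc => by
    rw [hf n _ hc, hej]
  have hDe : ∀ n (c : ↥(j '' U)), c ∈ subD (j '' U) (DSdom S n) (fSfun n) ↔
      e c ∈ D n ∧ f n (e c) ∈ U := by
    intro n c
    constructor
    · rintro ⟨hc, hcU⟩
      have hec : e c ∈ D n := (hD n _).2 ⟨by rwa [hej], by
        rw [hej]; exact image_subset_range _ _ hcU⟩
      refine ⟨hec, ?_⟩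
      rw [← hfe n c hec] at hcU
      exact (hinj.mem_set_image).1 hcU
    · rintro ⟨hc, hcU⟩
      refine ⟨?_, ?_⟩
      · rw [← hej]
        exact ((hD n _).1 hc).1
      · rw [← hfe n c hc]
        exact mem_image_of_mem j hcU
  have hconv := h.comap he (hrange.symm ▸ hU)
    (D' := fun n => subD (j '' U) (DSdom S n) (fSfun n)) (f' := fun n => subF (j '' U) (fSfun n))
    (fun n c => by rw [hrange]; exact hDe n c)
    (fun n c hc => hinj (by
      rw [hej, hfe n c ((hDe n c).1 hc).1, subF, dif_pos hc.2]))
  have hle : tX.induced e ≤ subTop inferInstance (j '' U) := by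
    have : (Subtype.val : ↥(j '' U) → Cantor) = j ∘ e := funext fun c => (hej c).symm
    rw [subTop, this, ← induced_compose]
    exact induced_mono hj.le_induced
  obtain ⟨n, hn, γ, hγ, hS⟩ := hH _ hC _ hle hconv l p
  refine ⟨n, hn, e γ, heU γ, ((hDe n γ).1 hγ).1, ((hDe n γ).1 hγ).2, fun m hm => ?_⟩
  rw [hej]
  have hmem := Set.ext_iff.1 hS (cardOnes γ n + m)
  constructor
  · intro hmS
    obtain ⟨m', ⟨hm', -⟩, heq⟩ := hmem.2 ⟨hmS, by simp, by simpa using hm⟩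
    rwa [← Nat.add_left_cancel heq]
  · intro hmS
    exact (hmem.1 ⟨m, ⟨hmS, hm⟩, rfl⟩).1

/-- A finite stage of the construction of a copy of the Cantor space: a clopen set, the maps
obtained by composing flips along a finite binary sequence, and the last coordinate flipped. -/
structure FlipStage (X : Type) where
  carrier : Set X
  shift : Cantor → X → X
  last : ℕ

/-- The carrier is a nonempty clopen set, on which the finitely many shifts are continuous. -/
structure FlipStage.Admissible {X : Type} [TopologicalSpace X] (s : FlipStage X) : Prop where
  isClopen : IsClopen s.carrier
  nonempty : s.carrier.Nonempty
  finite : (range s.shift).Finite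
  continuousOn : ∀ α, ContinuousOn (s.shift α) s.carrier

/-- `s'` refines the `k`-th stage `s` by one more flip `f s'.last`. -/
structure FlipStage.Refines {X : Type} [MetricSpace X] (S : Set ℕ) (j : X → Cantor)
    (D : ℕ → Set X) (f : ℕ → X → X) (k : ℕ) (s s' : FlipStage X) : Prop where
  lt : s.last < s'.last
  subset : s'.carrier ⊆ s.carrier
  subset_dom : s'.carrier ⊆ D s'.last
  mapsTo : MapsTo (f s'.last) s'.carrier s.carrier
  shift_eq : ∀ α z, s'.shift α z = if α k then s.shift α (f s'.last z) else s.shift α z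
  dist_le : ∀ α, ∀ z ∈ s'.carrier, ∀ w ∈ s'.carrier,
    dist (s'.shift α z) (s'.shift α w) ≤ (1 / 2) ^ k
  card : ∀ z ∈ s'.carrier, ∀ m ≤ k, cardOnes (j z) s'.last + m ∈ S ↔ m ∈ S

theorem FlipStage.Admissible.exists_refines {X : Type} [MetricSpace X] {S : Set ℕ}
    {j : X → Cantor} (hj : Continuous j) {D : ℕ → Set X} {f : ℕ → X → X}
    (hbasis : TopologicalSpace.IsTopologicalBasis {s : Set X | IsClopen s})
    (hD : ∀ n, IsOpen (D n)) (hf : ∀ n, ContinuousOn (f n) (D n))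
    (hflip : ∀ U : Set X, IsClopen U → U.Nonempty → ∀ l p : ℕ, ∃ n, l ≤ n ∧ ∃ x ∈ U, x ∈ D n ∧
      f n x ∈ U ∧ ∀ m ≤ p, cardOnes (j x) n + m ∈ S ↔ m ∈ S)
    {s : FlipStage X} (hs : s.Admissible) (k : ℕ) :
    ∃ s' : FlipStage X, s'.Admissible ∧ s.Refines S j D f k s' := by
  obtain ⟨n, hn, x, hxU, hxD, hfxU, hcard⟩ :=
    hflip s.carrier hs.isClopen hs.nonempty (s.last + 1) k
  set T : Cantor → X → X := fun α z => if α k then s.shift α (f n z) else s.shift α z with hT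
  have hfin : (range T).Finite := by
    refine (hs.finite.union (hs.finite.image fun g => g ∘ f n)).subset ?_
    rintro _ ⟨α, rfl⟩
    by_cases hα : α k = true
    · exact Or.inr ⟨_, mem_range_self α, by ext z; simp [hT, hα]⟩
    · exact Or.inl ⟨α, by ext z; simp [hT, hα]⟩
  have hcont : ∀ α, ContinuousOn (T α) (s.carrier ∩ (D n ∩ f n ⁻¹' s.carrier)) := by
    intro α
    by_cases hα : α k = true
    · simp only [hT, hα, if_true]
      exact (hs.continuousOn α).comp ((hf n).mono fun z hz => hz.2.1) fun z hz => hz.2.2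
    · simp only [hT, hα]
      exact (hs.continuousOn α).mono inter_subset_left
  have hopen : IsOpen (s.carrier ∩ (D n ∩ f n ⁻¹' s.carrier)) :=
    hs.isClopen.isOpen.inter ((hf n).isOpen_inter_preimage (hD n) hs.isClopen.isOpen)
  have hxmem : x ∈ s.carrier ∩ (D n ∩ f n ⁻¹' s.carrier) := ⟨hxU, hxD, hfxU⟩
  have hdist : ∀ᶠ z in 𝓝 x, ∀ g ∈ range T, dist (g z) (g x) < (1 / 2) ^ k / 2 := by
    rw [Filter.eventually_all_finite hfin]
    rintro _ ⟨α, rfl⟩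
    exact Metric.tendsto_nhds.1 ((hcont α).continuousAt (hopen.mem_nhds hxmem)) _ (by positivity)
  have hagree : ∀ᶠ z in 𝓝 x, ∀ i ∈ Iio n, j z i = j x i := by
    rw [Filter.eventually_all_finite (finite_Iio n)]
    intro i _
    exact ((continuous_apply i).comp hj).continuousAt.eventually
      (isOpen_discrete {j x i} |>.mem_nhds rfl)
  obtain ⟨V, hV, hxV, hVsub⟩ := hbasis.mem_nhds_iff.1
    ((hopen.eventually_mem hxmem).and (hdist.and hagree))
  refine ⟨⟨V, T, n⟩, ⟨hV, ⟨x, hxV⟩, hfin, fun α => (hcont α).mono fun z hz => (hVsub hz).1⟩,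
    hn, fun z hz => (hVsub hz).1.1, fun z hz => (hVsub hz).1.2.1, fun z hz => (hVsub hz).1.2.2,
    fun α z => rfl, fun α z hz w hw => ?_, fun z hz => ?_⟩
  · have h1 := (hVsub hz).2.1 _ (mem_range_self α)
    have h2 := (hVsub hw).2.1 _ (mem_range_self α)
    change dist (T α z) (T α w) ≤ _
    linarith [dist_triangle_right (T α z) (T α w) (T α x)]
  · have : cardOnes (j z) n = cardOnes (j x) n :=
      Finset.sum_congr rfl fun i hi => by rw [(hVsub hz).2.2 i (Finset.mem_range.1 hi)]
    change ∀ m ≤ k, cardOnes (j z) n + m ∈ S ↔ m ∈ S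
    rwa [this]

/-- A copy of the Cantor space on which flips are carried to flips. -/
theorem exists_continuous_flip_copy {X : Type} [TopologicalSpace X] [PolishSpace X] [Nonempty X]
    {S : Set ℕ} {j : X → Cantor} (hj : Continuous j) {D : ℕ → Set X} {f : ℕ → X → X}
    (hbasis : TopologicalSpace.IsTopologicalBasis {s : Set X | IsClopen s})
    (hD : ∀ n, IsOpen (D n)) (hf : ∀ n, ContinuousOn (f n) (D n))
    (hjD : ∀ n, ∀ x ∈ D n, j x n = false) (hjf : ∀ n, ∀ x ∈ D n, j (f n x) = fSfun n (j x))
    (hflip : ∀ U : Set X, IsClopen U → U.Nonempty → ∀ l p : ℕ, ∃ n, l ≤ n ∧ ∃ x ∈ U, x ∈ D n ∧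
      f n x ∈ U ∧ ∀ m ≤ p, cardOnes (j x) n + m ∈ S ↔ m ∈ S) :
    ∃ (u : Cantor → X) (n : ℕ → ℕ), Continuous u ∧ StrictMono n ∧
      (∀ α m, j (u α) (n m) = α m) ∧
      (∀ α, ∀ i ∉ range n, j (u α) i = j (u fun _ => false) i) ∧
      ∀ k, ∀ m ≤ k, cardOnes (j (u fun _ => false)) (n k) + m ∈ S ↔ m ∈ S := by
  let := TopologicalSpace.upgradeIsCompletelyMetrizable X
  have hstart : (FlipStage.mk (univ : Set X) (fun _ => id) 0).Admissible :=
    ⟨isClopen_univ, univ_nonempty, by simp, fun _ => continuousOn_id⟩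
  choose next hnext hrefines using fun (k : ℕ) (s : {s : FlipStage X // s.Admissible}) =>
    s.2.exists_refines hj hbasis hD hf hflip k
  let st : ℕ → {s : FlipStage X // s.Admissible} :=
    fun k => Nat.rec ⟨_, hstart⟩ (fun k s => ⟨next k s, hnext k s⟩) k
  have hst : ∀ k, (st k).1.Refines S j D f k (st (k + 1)).1 := fun k => hrefines k (st k)
  set U : ℕ → Set X := fun k => (st k).1.carrier
  set T : ℕ → Cantor → X → X := fun k => (st k).1.shift
  set n : ℕ → ℕ := fun k => (st (k + 1)).1.last
  have hmono : StrictMono n := strictMono_nat_of_lt_succ fun k => (hst (k + 1)).lt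
  have hanti : Antitone U := antitone_nat_of_succ_le fun k => (hst k).subset
  have hTsucc : ∀ k α z, T (k + 1) α z = if α k then T k α (f (n k) z) else T k α z :=
    fun k => (hst k).shift_eq
  have himage : ∀ α, Antitone fun k => T k α '' U k := by
    intro α
    refine antitone_nat_of_succ_le fun k => ?_
    rintro _ ⟨z, hz, rfl⟩
    rw [hTsucc]
    split_ifs
    · exact mem_image_of_mem _ ((hst k).mapsTo hz)
    · exact mem_image_of_mem _ ((hst k).subset hz)
  have hTzero : ∀ k z, T k (fun _ => false) z = z := by
    intro k
    induction k with
    | zero => exact fun z => rfl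
    | succ k ih => intro z; rw [hTsucc]; simpa using ih z
  have hTcongr : ∀ k (α β : Cantor), (∀ i < k, α i = β i) → ∀ z, T k α z = T k β z := by
    intro k
    induction k with
    | zero => exact fun α β _ z => rfl
    | succ k ih =>
      intro α β h z
      have ih' := ih α β fun i hi => h i (by omega)
      rw [hTsucc, hTsucc, h k (by omega), ih', ih']
  have hfalse : ∀ k m, m < k → ∀ z ∈ U k, j z (n m) = false := fun k m hm z hz =>
    hjD _ _ ((hst m).subset_dom (hanti hm hz))
  have hcoord : ∀ k α, ∀ z ∈ U k, (∀ m < k, j (T k α z) (n m) = α m) ∧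
      ∀ i, (∀ m < k, i ≠ n m) → j (T k α z) i = j z i := by
    intro k α
    induction k with
    | zero => exact fun z _ => ⟨by simp, fun i _ => rfl⟩
    | succ k ih =>
      intro z hz
      have hjz := hjf _ _ ((hst k).subset_dom hz)
      rw [hTsucc]
      split_ifs with hα
      · obtain ⟨h1, h2⟩ := ih _ ((hst k).mapsTo hz)
        refine ⟨fun m hm => ?_, fun i hi => ?_⟩
        · rcases Nat.lt_succ_iff_lt_or_eq.1 hm with hm | rfl
          · exact h1 m hm
          · rw [h2 _ fun q hq => (hmono hq).ne', hjz, hα]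
            exact Function.update_self ..
        · rw [h2 i fun m hm => hi m (by omega), hjz]
          exact Function.update_of_ne (hi k (by omega)) ..
      · obtain ⟨h1, h2⟩ := ih _ ((hst k).subset hz)
        refine ⟨fun m hm => ?_, fun i hi => h2 i fun m hm => hi m (by omega)⟩
        rcases Nat.lt_succ_iff_lt_or_eq.1 hm with hm | rfl
        · exact h1 m hm
        · rw [h2 _ fun q hq => (hmono hq).ne', hfalse _ m hm z hz]
          simpa using hα
  choose x hx using fun k => (st k).2.nonempty
  set w : Cantor → ℕ → X := fun α k => T (k + 1) α (x (k + 1)) with hw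
  have hwmem : ∀ α k l, k ≤ l → w α l ∈ T (k + 1) α '' U (k + 1) := fun α k l hkl =>
    himage α (Nat.succ_le_succ hkl) (mem_image_of_mem _ (hx (l + 1)))
  have hdist : ∀ α k, ∀ y ∈ T (k + 1) α '' U (k + 1), ∀ z ∈ T (k + 1) α '' U (k + 1),
      dist y z ≤ (1 / 2) ^ k := by
    rintro α k _ ⟨y, hy, rfl⟩ _ ⟨z, hz, rfl⟩
    exact (hst k).dist_le α y hy z hz
  have hpow : Filter.Tendsto (fun k : ℕ => (1 / 2 : ℝ) ^ k) Filter.atTop (𝓝 0) :=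
    tendsto_pow_atTop_nhds_zero_of_lt_one (by norm_num) (by norm_num)
  have hcauchy : ∀ α, CauchySeq (w α) := fun α =>
    cauchySeq_of_le_tendsto_0 _ (fun a b N ha hb =>
      hdist α N _ (hwmem α N a ha) _ (hwmem α N b hb)) hpow
  choose u hu using fun α => cauchySeq_tendsto_of_complete (hcauchy α)
  have hju : ∀ α i b, (∀ᶠ k in Filter.atTop, j (w α k) i = b) → j (u α) i = b := by
    intro α i b h
    have h1 : Filter.Tendsto (fun k => j (w α k) i) Filter.atTop (𝓝 (j (u α) i)) :=
      (((continuous_apply i).comp hj).tendsto (u α)).comp (hu α)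
    exact tendsto_nhds_unique h1 (tendsto_const_nhds.congr' (h.mono fun k hk => hk.symm))
  refine ⟨u, n, ?_, hmono, ?_, ?_, ?_⟩
  · rw [continuous_iff_continuousAt]
    intro α
    refine Metric.tendsto_nhds.2 fun ε hε => ?_
    obtain ⟨k, hk⟩ := (hpow.eventually (gt_mem_nhds hε)).exists
    have hagree : ∀ᶠ β in 𝓝 α, ∀ i ∈ Iio (k + 1), β i = α i := by
      rw [Filter.eventually_all_finite (finite_Iio _)]
      intro i _
      exact (continuous_apply i).continuousAt.eventually (isOpen_discrete {α i} |>.mem_nhds rfl)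
    filter_upwards [hagree] with β hβ
    refine lt_of_le_of_lt (le_of_tendsto ((hu β).dist (hu α)) ?_) hk
    filter_upwards [Filter.eventually_ge_atTop k] with l hl
    have himg : T (k + 1) β '' U (k + 1) = T (k + 1) α '' U (k + 1) :=
      image_congr fun z _ => hTcongr (k + 1) β α hβ z
    exact hdist α k _ (himg ▸ hwmem β k l hl) _ (hwmem α k l hl)
  · intro α m
    refine hju α _ _ ?_
    filter_upwards [Filter.eventually_ge_atTop m] with k hk
    exact (hcoord (k + 1) α _ (hx (k + 1))).1 m (by omega)
  · intro α i hi
    have hne : ∀ m, i ≠ n m := fun m h => hi ⟨m, h.symm⟩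
    have hlim : Filter.Tendsto (fun k => j (w (fun _ => false) k) i) Filter.atTop
        (𝓝 (j (u fun _ => false) i)) :=
      (((continuous_apply i).comp hj).tendsto _).comp (hu _)
    refine hju α _ _ ?_
    filter_upwards [hlim.eventually (isOpen_discrete {j (u fun _ => false) i} |>.mem_nhds rfl)]
      with k hk
    refine Eq.trans ?_ hk
    rw [hw]
    simp only [hTzero]
    exact (hcoord (k + 1) α _ (hx (k + 1))).2 i fun m _ => hne m
  · intro k
    refine (hst k).card _ ((st (k + 1)).2.isClopen.isClosed.mem_of_tendsto (hu _) ?_)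
    filter_upwards [Filter.eventually_ge_atTop k] with l hl
    rw [hw]
    simp only [hTzero]
    exact hanti (by omega : k + 1 ≤ l + 1) (hx (l + 1))

/-- Coding a sequence along zero coordinates of another one adds up the numbers of ones. -/
theorem cardOnes_apply_strictMono {x y α : Cantor} {n : ℕ → ℕ} (hn : StrictMono n)
    (hy : ∀ m, y (n m) = α m) (hx : ∀ m, x (n m) = false) (hxy : ∀ i ∉ range n, y i = x i)
    (k : ℕ) : cardOnes y (n k) = cardOnes x (n k) + cardOnes α k := by
  have hcode : cardOnes α k =
      ∑ i ∈ Finset.range (n k), ∑ m ∈ Finset.range k, if n m = i ∧ α m = true then 1 else 0 := by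
    rw [Finset.sum_comm]
    refine Finset.sum_congr rfl fun m hm => ?_
    rw [Finset.sum_eq_single_of_mem (n m)
      (Finset.mem_range.2 (hn (Finset.mem_range.1 hm))) fun i _ hi => by simp [hi.symm]]
    simp
  rw [hcode, cardOnes, cardOnes, ← Finset.sum_add_distrib]
  refine Finset.sum_congr rfl fun i hi => ?_
  by_cases hir : i ∈ range n
  · obtain ⟨q, rfl⟩ := hir
    rw [Finset.sum_eq_single_of_mem q
      (Finset.mem_range.2 (hn.lt_iff_lt.1 (Finset.mem_range.1 hi)))
      fun m _ hm => by simp [hn.injective.ne hm]]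
    simp [hx, hy]
  · rw [hxy i hir, Finset.sum_eq_zero fun m _ => if_neg fun h => hir ⟨m, h.1⟩, add_zero]

theorem mem_ASet_iff {S : Set ℕ} {x y : Cantor} :
    (x, y) ∈ ASet S ↔ ∃ n, (x n = false ∧ cardOnes x n ∈ S) ∧ y = Function.update x n true :=
  mem_iUnion

theorem mem_ASet_apply_strictMono_iff {S : Set ℕ} {v : Cantor → Cantor} {n : ℕ → ℕ}
    (hn : StrictMono n) (hv : ∀ α m, v α (n m) = α m)
    (hv0 : ∀ α, ∀ i ∉ range n, v α i = v (fun _ => false) i)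
    (hS : ∀ k, ∀ m ≤ k, cardOnes (v fun _ => false) (n k) + m ∈ S ↔ m ∈ S) (α β : Cantor) :
    (v α, v β) ∈ ASet S ↔ (α, β) ∈ ASet S := by
  have hcard : ∀ k, cardOnes (v α) (n k) ∈ S ↔ cardOnes α k ∈ S := by
    intro k
    rw [cardOnes_apply_strictMono hn (hv α) (hv _) (hv0 α) k]
    refine hS k _ ?_
    calc cardOnes α k ≤ ∑ _i ∈ Finset.range k, 1 :=
          Finset.sum_le_sum fun i _ => by split_ifs <;> simp
      _ = k := by simp
  have hupd : ∀ k, v β = Function.update (v α) (n k) true ↔ β = Function.update α k true := by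
    intro k
    constructor
    · intro h
      ext m : 1
      rw [← hv β m, h]
      by_cases hm : m = k
      · simp [hm]
      · rw [Function.update_of_ne (hn.injective.ne hm), Function.update_of_ne hm, hv]
    · rintro rfl
      ext i : 1
      by_cases hi : i ∈ range n
      · obtain ⟨m, rfl⟩ := hi
        rw [hv]
        by_cases hm : m = k
        · simp [hm]
        · rw [Function.update_of_ne (hn.injective.ne hm), Function.update_of_ne hm, hv]
      · rw [Function.update_of_ne fun h => hi ⟨k, h.symm⟩, hv0 _ i hi, hv0 α i hi]
  simp only [mem_ASet_iff]
  constructor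
  · rintro ⟨i, ⟨hi, hiS⟩, hβ⟩
    have hir : i ∈ range n := by
      by_contra hir
      have := congrFun hβ i
      rw [hv0 β i hir, ← hv0 α i hir, hi] at this
      simp at this
    obtain ⟨k, rfl⟩ := hir
    exact ⟨k, ⟨hv α k ▸ hi, (hcard k).1 hiS⟩, (hupd k).1 hβ⟩
  · rintro ⟨k, ⟨hk, hkS⟩, hβ⟩
    exact ⟨n k, ⟨(hv α k).trans hk, (hcard k).2 hkS⟩, (hupd k).2 hβ⟩

theorem mem_restrGraphs_iff {X : Type} {B : Set X} {D : ℕ → Set X} {f : ℕ → X → X} {x y : ↥B} :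
    (x, y) ∈ restrGraphs B D f ↔ ((x : X), (y : X)) ∈ unionGraphs D f := by
  simp only [restrGraphs, unionGraphs, graphRel, mem_iUnion]
  refine exists_congr fun n => ⟨?_, ?_⟩
  · rintro ⟨⟨hxD, hxB⟩, hy⟩
    refine ⟨hxD, ?_⟩
    change y = subF B (f n) x at hy
    rw [hy, subF, dif_pos hxB]
  · rintro ⟨hxD, hy⟩
    have hxB : f n x ∈ B := hy ▸ y.2
    refine ⟨⟨hxD, hxB⟩, ?_⟩
    change y = subF B (f n) x
    rw [subF, dif_pos hxB]
    exact Subtype.ext hy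

/-- In a converging situation admitting a continuous injection into the Cantor space which carries
the partial maps to flips, Condition (H) yields a continuous reduction of `A^S`. -/
theorem CondH.exists_continuous_reduction {S : Set ℕ} (hH : CondH S) {X : Type}
    [tX : TopologicalSpace X] {j : X → Cantor} (hj : Continuous j) (hinj : Function.Injective j)
    {D : ℕ → Set X} {f : ℕ → X → X}
    (hD : ∀ n x, x ∈ D n ↔ j x ∈ DSdom S n ∧ fSfun n (j x) ∈ range j)
    (hf : ∀ n, ∀ x ∈ D n, j (f n x) = fSfun n (j x)) (h : ConvSit X tX D f) :
    ∃ u : Cantor → X, Continuous u ∧ ∀ α β, (j (u α), j (u β)) ∈ ASet S ↔ (α, β) ∈ ASet S := by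
  have hne := h.1
  have hpol := h.2.1
  obtain ⟨u, n, hu, hn, hv, hv0, hS⟩ := exists_continuous_flip_copy hj h.2.2.1
    (fun n => (h.2.2.2.2.1 n).1.isOpen) (fun n => (h.2.2.2.2.1 n).2.2.1)
    (fun n x hx => ((hD n x).1 hx).1.1) hf
    (fun U hU hUne => hH.exists_mem_clopen hj hinj hD hf h hU hUne)
  exact ⟨u, hu, mem_ASet_apply_strictMono_iff (v := fun α => j (u α)) hn hv hv0 hS⟩

theorem stmt10 (S : Set ℕ) (hinf : S.Infinite) (h0 : 0 ∈ S) (hH : CondH S)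
    (B : Set Cantor) (hB : @MeasurableSet Cantor (borel Cantor) B)
    (τ : TopologicalSpace ↥B) (hτ : τ ≤ subTop inferInstance B)
    (hconv : ConvSit ↥B τ (fun n => subD B (DSdom S n) (fSfun n)) (fun n => subF B (fSfun n))) :
    RedRC inferInstance inferInstance τ τ (ASet S) (restrGraphs B (DSdom S) fSfun) := by
  obtain ⟨u, hu, hred⟩ := hH.exists_continuous_reduction (tX := τ) (j := Subtype.val)
    (continuous_iff_le_induced.2 hτ) Subtype.val_injective
    (fun n x => by rw [Subtype.range_val]; rfl)
    (fun n x hx => by rw [subF, dif_pos hx.2]) hconv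
  refine ⟨u, u, hu, hu, ?_⟩
  ext ⟨α, β⟩
  exact (hred α β).symm.trans mem_restrGraphs_iff.symm
end
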